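/- arXiv:2502.16904 — 2 statements merged into one kernel-verified Lean document; each statement's English description precedes it below -/
import Mathlib

section
/- Let τ be a sufficiently smooth function on [0,1] with τ(0) = 0 and let u be a sufficiently smooth function on (0,1]. Then: (i) for every nonnegative integer m there exists C = C(m) > 0 such that ‖(τu)''‖_{Y^m} ≤ C ‖τ'‖_{X^{m+1}} ‖u‖_{Y^{max(m+2,3)}}; (ii) for every ε > 0 there exists C = C(ε) > 0 such that ‖s^ε (τu)''‖_{Y^0} ≤ C ( ‖τ'‖_{L^∞(0,1)} + ‖τ''‖_{Y^0} ) ‖u‖_{Y²}, where ‖s^ε w‖_{Y^0} = (∫₀¹ s^{1+2ε}|w(s)|² ds)^{1/2}. -/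
open MeasureTheory ENNReal RealInnerProductSpace

noncomputable section

/-- The weighted L² norm `‖s^α v‖_{L²(0,1)} = (∫₀¹ s^{2α} ‖v s‖² ds)^{1/2}`, valued in `[0,∞]`. -/
def wL2 {E : Type*} [NormedAddCommGroup E] (α : ℝ) (v : ℝ → E) : ℝ≥0∞ :=
  (∫⁻ s in Set.Ioo (0:ℝ) 1, ENNReal.ofReal (s ^ (2 * α) * ‖v s‖ ^ 2)) ^ ((1:ℝ) / 2)

/-- The weighted L^∞ norm `‖s^α v‖_{L^∞(0,1)} = sup_{0<s<1} s^α ‖v s‖`, valued in `[0,∞]`. -/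
def wLinf {E : Type*} [NormedAddCommGroup E] (α : ℝ) (v : ℝ → E) : ℝ≥0∞ :=
  ⨆ s : Set.Ioo (0:ℝ) 1, ENNReal.ofReal ((s : ℝ) ^ α * ‖v (s : ℝ)‖)

/-- The square of the weighted Sobolev norm `X^m` on `(0,1)`:
for `m = 2k`, `‖u‖_{X^m}² = Σ_{i=0}^{k} ‖∂^i u‖² + Σ_{j=1}^{k} ‖s^j ∂^{k+j} u‖²`;
for `m = 2k+1`, `‖u‖_{X^m}² = Σ_{i=0}^{k} ‖∂^i u‖² + Σ_{j=1}^{k+1} ‖s^{j-1/2} ∂^{k+j} u‖²`. -/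
def XnormSq {E : Type*} [NormedAddCommGroup E] [NormedSpace ℝ E] (m : ℕ) (u : ℝ → E) : ℝ≥0∞ :=
  if m % 2 = 0 then
    (∑ i ∈ Finset.range (m / 2 + 1), wL2 0 (iteratedDeriv i u) ^ 2) +
      ∑ j ∈ Finset.range (m / 2), wL2 ((j : ℝ) + 1) (iteratedDeriv (m / 2 + j + 1) u) ^ 2
  else
    (∑ i ∈ Finset.range (m / 2 + 1), wL2 0 (iteratedDeriv i u) ^ 2) +
      ∑ j ∈ Finset.range (m / 2 + 1), wL2 ((j : ℝ) + 1 / 2) (iteratedDeriv (m / 2 + j + 1) u) ^ 2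

/-- The weighted Sobolev norm `X^m`, valued in `[0,∞]`. -/
def Xnorm {E : Type*} [NormedAddCommGroup E] [NormedSpace ℝ E] (m : ℕ) (u : ℝ → E) : ℝ≥0∞ :=
  XnormSq m u ^ ((1:ℝ) / 2)

/-- The square of the companion weighted Sobolev norm `Y^m` on `(0,1)`:
for `m = 2k`, `‖u‖_{Y^m}² = Σ_{i=0}^{k-1} ‖∂^i u‖² + Σ_{j=1}^{k+1} ‖s^{j-1/2} ∂^{k+j-1} u‖²`;
for `m = 2k+1`, `‖u‖_{Y^m}² = Σ_{i=0}^{k} ‖∂^i u‖² + Σ_{j=1}^{k+1} ‖s^{j} ∂^{k+j} u‖²`. -/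
def YnormSq {E : Type*} [NormedAddCommGroup E] [NormedSpace ℝ E] (m : ℕ) (u : ℝ → E) : ℝ≥0∞ :=
  if m % 2 = 0 then
    (∑ i ∈ Finset.range (m / 2), wL2 0 (iteratedDeriv i u) ^ 2) +
      ∑ j ∈ Finset.range (m / 2 + 1), wL2 ((j : ℝ) + 1 / 2) (iteratedDeriv (m / 2 + j) u) ^ 2
  else
    (∑ i ∈ Finset.range (m / 2 + 1), wL2 0 (iteratedDeriv i u) ^ 2) +
      ∑ j ∈ Finset.range (m / 2 + 1), wL2 ((j : ℝ) + 1) (iteratedDeriv (m / 2 + j + 1) u) ^ 2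

/-- The weighted Sobolev norm `Y^m`, valued in `[0,∞]`. -/
def Ynorm {E : Type*} [NormedAddCommGroup E] [NormedSpace ℝ E] (m : ℕ) (u : ℝ → E) : ℝ≥0∞ :=
  YnormSq m u ^ ((1:ℝ) / 2)


namespace Aux
open Set

abbrev Sm (f : ℝ → ℝ) : Prop := ContDiffOn ℝ (⊤ : ℕ∞) f (Set.Ioi 0)

abbrev mu : Measure ℝ := volume.restrict (Set.Ioo (0:ℝ) 1)

lemma Sm.deriv {f : ℝ → ℝ} (h : Sm f) : Sm (deriv f) :=
  ContDiffOn.deriv_of_isOpen h isOpen_Ioi (by simp)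

lemma Sm.iter {f : ℝ → ℝ} (h : Sm f) (n : ℕ) : Sm (iteratedDeriv n f) := by
  induction n with
  | zero => simpa [iteratedDeriv_zero] using h
  | succ n ih => rw [iteratedDeriv_succ]; exact ih.deriv

lemma Sm.cda {f : ℝ → ℝ} (h : Sm f) {s : ℝ} (hs : 0 < s) :
    ContDiffAt ℝ (⊤ : ℕ∞) f s := ContDiffOn.contDiffAt h (Ioi_mem_nhds hs)

lemma Sm.aem {f : ℝ → ℝ} (h : Sm f) : AEMeasurable f mu :=
  (h.continuousOn.mono (fun _ hx => hx.1)).aemeasurable measurableSet_Ioo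

lemma Sm.mul {f g : ℝ → ℝ} (h : Sm f) (h' : Sm g) : Sm (fun s => f s * g s) :=
  ContDiffOn.mul h h'

/-- weighted norm as a lintegral of enorms -/
lemma wL2_eq (α : ℝ) (v : ℝ → ℝ) :
    wL2 α v = (∫⁻ s, (ENNReal.ofReal (s ^ α) * ‖v s‖ₑ) ^ (2:ℝ) ∂mu) ^ ((1:ℝ)/2) := by
  unfold wL2
  congr 1
  apply setLIntegral_congr_fun measurableSet_Ioo
  intro s hs
  have h0 : (0:ℝ) ≤ s ^ α := Real.rpow_nonneg hs.1.le _
  simp only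
  rw [Real.enorm_eq_ofReal_abs, ← ENNReal.ofReal_mul h0, ENNReal.rpow_two,
    ← ENNReal.ofReal_pow (by positivity), mul_pow, two_mul, Real.rpow_add hs.1, ← pow_two,
    Real.norm_eq_abs]

lemma wL2_eq_eLp (α : ℝ) (v : ℝ → ℝ) :
    wL2 α v = eLpNorm (fun s => s ^ α * v s) 2 mu := by
  rw [wL2_eq, eLpNorm_eq_lintegral_rpow_enorm_toReal (by norm_num) (by norm_num)]
  simp only [ENNReal.toReal_ofNat]
  congr 1
  apply setLIntegral_congr_fun measurableSet_Ioo
  intro s hs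
  have h0 : (0:ℝ) ≤ s ^ α := Real.rpow_nonneg hs.1.le _
  simp only
  rw [enorm_mul, Real.enorm_eq_ofReal h0]

lemma wL2_congr (α : ℝ) {v w : ℝ → ℝ} (h : ∀ s ∈ Ioo (0:ℝ) 1, v s = w s) :
    wL2 α v = wL2 α w := by
  unfold wL2
  congr 1
  apply setLIntegral_congr_fun measurableSet_Ioo
  intro s hs
  simp only [h s hs]

lemma aem_w {v : ℝ → ℝ} (h : AEMeasurable v mu) (α : ℝ) :
    AEMeasurable (fun s : ℝ => s ^ α * v s) mu :=
  (measurable_id.pow_const α).aemeasurable.mul h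

lemma wL2_sum (α : ℝ) {ι : Type} (F : Finset ι) (c : ι → ℝ) (v : ι → ℝ → ℝ)
    (h : ∀ i ∈ F, AEMeasurable (v i) mu) :
    wL2 α (fun s => ∑ i ∈ F, c i * v i s) ≤ ∑ i ∈ F, ENNReal.ofReal |c i| * wL2 α (v i) := by
  have e : (fun s => s ^ α * ∑ i ∈ F, c i * v i s) =
      ∑ i ∈ F, c i • (fun s : ℝ => s ^ α * v i s) := by
    ext s
    simp only [Finset.sum_apply, Pi.smul_apply, smul_eq_mul, Finset.mul_sum]
    exact Finset.sum_congr rfl (fun i _ => by ring)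
  rw [wL2_eq_eLp, e]
  refine (eLpNorm_sum_le (fun i hi => ?_) (by norm_num)).trans ?_
  · exact ((aem_w (h i hi) α).const_mul (c i)).aestronglyMeasurable
  · apply Finset.sum_le_sum
    intro i _
    rw [eLpNorm_const_smul, Real.enorm_eq_ofReal_abs, wL2_eq_eLp]

/-- product estimate -/
lemma wL2_mul_le {α β δ : ℝ} (hd : α + β ≤ δ) {g h : ℝ → ℝ} (hh : AEMeasurable h mu)
    (M : ℝ≥0∞) (hM : ∀ s ∈ Ioo (0:ℝ) 1, ENNReal.ofReal (s ^ β * |g s|) ≤ M) :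
    wL2 δ (fun s => g s * h s) ≤ M * wL2 α h := by
  rw [wL2_eq, wL2_eq]
  have hm : AEMeasurable (fun s => (ENNReal.ofReal (s ^ α) * ‖h s‖ₑ) ^ (2:ℝ)) mu :=
    (((measurable_id.pow_const α).ennreal_ofReal.aemeasurable).mul hh.enorm).pow_const _
  have : ∫⁻ s, (ENNReal.ofReal (s ^ δ) * ‖g s * h s‖ₑ) ^ (2:ℝ) ∂mu ≤
      M ^ (2:ℝ) * ∫⁻ s, (ENNReal.ofReal (s ^ α) * ‖h s‖ₑ) ^ (2:ℝ) ∂mu := by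
    rw [← lintegral_const_mul'' _ hm]
    apply setLIntegral_mono' measurableSet_Ioo
    intro s hs
    rw [← ENNReal.mul_rpow_of_nonneg _ _ (by norm_num)]
    apply ENNReal.rpow_le_rpow _ (by norm_num)
    have h1 : s ^ δ ≤ s ^ β * s ^ α := by
      rw [← Real.rpow_add hs.1]
      exact Real.rpow_le_rpow_of_exponent_ge hs.1 hs.2.le (by linarith)
    have hb : 0 ≤ s ^ β := Real.rpow_nonneg hs.1.le _
    calc ENNReal.ofReal (s ^ δ) * ‖g s * h s‖ₑ
        ≤ ENNReal.ofReal (s ^ β * s ^ α) * ‖g s * h s‖ₑ := by gcongr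
      _ = ENNReal.ofReal (s ^ β * |g s|) * (ENNReal.ofReal (s ^ α) * ‖h s‖ₑ) := by
          rw [enorm_mul, ENNReal.ofReal_mul hb, ENNReal.ofReal_mul hb, Real.enorm_eq_ofReal_abs (g s)]
          ring
      _ ≤ _ := by gcongr; exact hM s hs
  calc _ ≤ (M ^ (2:ℝ) * ∫⁻ s, (ENNReal.ofReal (s ^ α) * ‖h s‖ₑ) ^ (2:ℝ) ∂mu) ^ ((1:ℝ)/2) :=
        ENNReal.rpow_le_rpow this (by norm_num)
    _ = _ := by
        rw [ENNReal.mul_rpow_of_nonneg _ _ (by norm_num), ← ENNReal.rpow_mul]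
        norm_num

/-- Cauchy-Schwarz -/
lemma cs (a κ : ℝ) {g : ℝ → ℝ} (hg : AEMeasurable g mu) :
    ∫⁻ r, ENNReal.ofReal (r ^ a) * ‖g r‖ₑ ∂mu ≤
      (∫⁻ r, ENNReal.ofReal (r ^ (2 * (a - κ))) ∂mu) ^ ((1:ℝ)/2) * wL2 κ g := by
  rw [wL2_eq]
  have m1 : AEMeasurable (fun r : ℝ => ENNReal.ofReal (r ^ (a - κ))) mu :=
    (measurable_id.pow_const _).ennreal_ofReal.aemeasurable
  have m2 : AEMeasurable (fun r : ℝ => ENNReal.ofReal (r ^ κ) * ‖g r‖ₑ) mu :=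
    ((measurable_id.pow_const κ).ennreal_ofReal.aemeasurable).mul hg.enorm
  have H := ENNReal.lintegral_mul_le_Lp_mul_Lq mu Real.HolderConjugate.two_two m1 m2
  refine le_trans (le_of_eq ?_) (H.trans (le_of_eq ?_))
  · apply setLIntegral_congr_fun measurableSet_Ioo
    intro r hr
    simp only [Pi.mul_apply]
    rw [← mul_assoc, ← ENNReal.ofReal_mul (Real.rpow_nonneg hr.1.le _), ← Real.rpow_add hr.1]
    congr 3; ring
  · congr 2
    apply setLIntegral_congr_fun measurableSet_Ioo
    intro r hr
    simp only
    rw [ENNReal.ofReal_rpow_of_nonneg (Real.rpow_nonneg hr.1.le _) (by norm_num),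
      ← Real.rpow_mul hr.1.le, mul_comm]

lemma const_fin {e : ℝ} (he : -1 < e) :
    ∫⁻ r, ENNReal.ofReal (r ^ e) ∂mu < ∞ := by
  have h := (intervalIntegral.intervalIntegrable_rpow' (a := 0) (b := 1) he).1
  have h2 : IntegrableOn (fun r : ℝ => r ^ e) (Ioo 0 1) := h.mono_set Ioo_subset_Ioc_self
  refine lt_of_le_of_lt (lintegral_mono fun r => ?_) h2.2
  exact Real.ofReal_le_enorm _

lemma ftc {f : ℝ → ℝ} (hf : Sm f) {s t : ℝ} (hs : 0 < s) (ht : 0 < t) :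
    ‖f s‖ₑ ≤ ‖f t‖ₑ + ∫⁻ r in Set.uIoc t s, ‖deriv f r‖ₑ := by
  have hsub : Set.uIcc t s ⊆ Ioi 0 := fun x hx => lt_of_lt_of_le (lt_min ht hs) hx.1
  have hd : ContinuousOn (deriv f) (Set.uIcc t s) := hf.deriv.continuousOn.mono hsub
  have h := intervalIntegral.integral_deriv_eq_sub (f := f) (a := t) (b := s)
    (fun x hx => (hf.cda (hsub hx)).differentiableAt (by simp)) hd.intervalIntegrable
  have h2 : f s = f t + ∫ y in t..s, deriv f y := by rw [h]; ring
  rw [h2]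
  refine (enorm_add_le _ _).trans ?_
  gcongr
  have : ‖∫ y in t..s, deriv f y‖ₑ = ‖∫ y in Set.uIoc t s, deriv f y‖ₑ := by
    rw [← ofReal_norm, ← ofReal_norm, intervalIntegral.norm_intervalIntegral_eq]
  rw [this]
  exact enorm_integral_le_lintegral_enorm _

/-- main embedding -/
lemma emb (α κ γ : ℝ) (hα : 0 ≤ α) (hγ : 0 ≤ γ) (hk : κ - 1/2 < γ) :
    ∃ C : NNReal, ∀ f : ℝ → ℝ, Sm f → ∀ s ∈ Ioo (0:ℝ) 1,
      ENNReal.ofReal (s ^ γ * |f s|) ≤ C * (wL2 α f + wL2 κ (deriv f)) := by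
  set K1 := (∫⁻ r, ENNReal.ofReal (r ^ (2 * (α - α))) ∂mu) ^ ((1:ℝ)/2) with hK1
  set K2 := (∫⁻ r, ENNReal.ofReal (r ^ (2 * (γ - κ))) ∂mu) ^ ((1:ℝ)/2) with hK2
  have f1 : K1 ≠ ∞ := (ENNReal.rpow_lt_top_of_nonneg (by norm_num)
    (const_fin (by norm_num)).ne).ne
  have f2 : K2 ≠ ∞ := (ENNReal.rpow_lt_top_of_nonneg (by norm_num)
    (const_fin (by linarith)).ne).ne
  set D : ℝ≥0∞ := 2 * (ENNReal.ofReal (2 ^ α) * K1 + ENNReal.ofReal (2 ^ γ) * K2) with hD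
  have fD : D ≠ ∞ := by
    apply ENNReal.mul_ne_top (by norm_num)
    exact ENNReal.add_ne_top.2 ⟨ENNReal.mul_ne_top ENNReal.ofReal_ne_top f1,
      ENNReal.mul_ne_top ENNReal.ofReal_ne_top f2⟩
  refine ⟨D.toNNReal, fun f hf s hs => ?_⟩
  rw [ENNReal.coe_toNNReal fD]
  set I := ∫⁻ r, ENNReal.ofReal (r ^ γ) * ‖deriv f r‖ₑ ∂mu with hI
  set J := ∫⁻ r, ENNReal.ofReal (r ^ α) * ‖f r‖ₑ ∂mu with hJ
  have hIle : I ≤ K2 * wL2 κ (deriv f) := cs γ κ hf.deriv.aem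
  have hJle : J ≤ K1 * wL2 α f := cs α α hf.aem
  set L := ENNReal.ofReal (s ^ γ * |f s|) with hL
  have hsg : 0 ≤ s ^ γ := Real.rpow_nonneg hs.1.le _
  have key : ∀ t ∈ Ioo (1/2:ℝ) 1, L ≤ ENNReal.ofReal (2 ^ α) * (ENNReal.ofReal (t ^ α) * ‖f t‖ₑ)
      + ENNReal.ofReal (2 ^ γ) * I := by
    intro t ht
    have t0 : 0 < t := by linarith [ht.1]
    have hLe : L = ENNReal.ofReal (s ^ γ) * ‖f s‖ₑ := by
      rw [hL, ENNReal.ofReal_mul hsg, Real.enorm_eq_ofReal_abs]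
    rw [hLe]
    refine (mul_le_mul_right (ftc hf hs.1 t0) _).trans ?_
    rw [mul_add]
    refine add_le_add ?_ ?_
    · rw [← mul_assoc, ← ENNReal.ofReal_mul (by positivity)]
      gcongr
      calc s ^ γ ≤ 1 := Real.rpow_le_one hs.1.le hs.2.le hγ
        _ ≤ (2 * t) ^ α := Real.one_le_rpow (by linarith [ht.1]) hα
        _ = _ := Real.mul_rpow (by norm_num) t0.le
    · rw [← lintegral_const_mul' _ _ ENNReal.ofReal_ne_top]
      have hss : Set.uIoc t s ⊆ Ioo 0 1 := fun x hx =>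
        ⟨(lt_min t0 hs.1).trans hx.1, hx.2.trans_lt (max_lt ht.2 hs.2)⟩
      calc _ ≤ ∫⁻ r in Set.uIoc t s, ENNReal.ofReal (2 ^ γ) * (ENNReal.ofReal (r ^ γ) * ‖deriv f r‖ₑ) := by
            apply setLIntegral_mono' measurableSet_uIoc
            intro r hr
            have r0 := (hss hr).1
            rw [← mul_assoc, ← ENNReal.ofReal_mul (by positivity)]
            gcongr
            rw [← Real.mul_rpow (by norm_num) r0.le]
            apply Real.rpow_le_rpow hs.1.le _ hγ
            rcases le_total t s with h | h
            · have := hr.1; rw [min_eq_left h] at this; linarith [ht.1, hs.2]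
            · have := hr.1; rw [min_eq_right h] at this; linarith
        _ ≤ ∫⁻ r, ENNReal.ofReal (2 ^ γ) * (ENNReal.ofReal (r ^ γ) * ‖deriv f r‖ₑ) ∂mu :=
            lintegral_mono_set hss
        _ = _ := lintegral_const_mul' _ _ ENNReal.ofReal_ne_top
  have int : ∫⁻ t in Ioo (1/2:ℝ) 1, L ≤ ENNReal.ofReal (2 ^ α) * J + ENNReal.ofReal (2 ^ γ) * I := by
    calc _ ≤ ∫⁻ t in Ioo (1/2:ℝ) 1, (ENNReal.ofReal (2 ^ α) * (ENNReal.ofReal (t ^ α) * ‖f t‖ₑ)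
      + ENNReal.ofReal (2 ^ γ) * I) := setLIntegral_mono' measurableSet_Ioo key
      _ ≤ ∫⁻ t, (ENNReal.ofReal (2 ^ α) * (ENNReal.ofReal (t ^ α) * ‖f t‖ₑ)
      + ENNReal.ofReal (2 ^ γ) * I) ∂mu := lintegral_mono_set (Ioo_subset_Ioo (by norm_num) le_rfl)
      _ = _ := by
        rw [lintegral_add_right _ measurable_const, lintegral_const_mul' _ _ ENNReal.ofReal_ne_top]
        simp
        rfl
  have hh : L = 2 * ∫⁻ t in Ioo (1/2:ℝ) 1, L := by
    rw [setLIntegral_const, Real.volume_Ioo, mul_comm L, ← mul_assoc]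
    have : (2:ℝ≥0∞) * ENNReal.ofReal (1 - 1/2) = 1 := by
      rw [show (2:ℝ≥0∞) = ENNReal.ofReal 2 by simp, ← ENNReal.ofReal_mul (by norm_num)]
      norm_num
    rw [this, one_mul]
  rw [hh]
  calc _ ≤ 2 * (ENNReal.ofReal (2 ^ α) * (K1 * wL2 α f) + ENNReal.ofReal (2 ^ γ) * (K2 * wL2 κ (deriv f))) := by
        refine mul_le_mul_right (int.trans ?_) _
        gcongr
    _ ≤ 2 * ((ENNReal.ofReal (2 ^ α) * K1 + ENNReal.ofReal (2 ^ γ) * K2) * wL2 α f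
          + (ENNReal.ofReal (2 ^ α) * K1 + ENNReal.ofReal (2 ^ γ) * K2) * wL2 κ (deriv f)) := by
        rw [← mul_assoc (ENNReal.ofReal (2 ^ α)), ← mul_assoc (ENNReal.ofReal (2 ^ γ))]
        gcongr
        · exact le_self_add
        · exact le_add_self
    _ = _ := by rw [hD]; ring

/-- bound of `τ` by the integral of `τ'` -/
lemma tau_int {τ : ℝ → ℝ} (h : ContDiffOn ℝ (⊤ : ℕ∞) τ (Set.Ici 0)) (h0 : τ 0 = 0) {s : ℝ}
    (hs : 0 < s) : ‖τ s‖ₑ ≤ ∫⁻ r in Set.Ioc 0 s, ‖deriv τ r‖ₑ := by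
  have hS : Sm τ := h.mono Ioi_subset_Ici_self
  have hc : Filter.Tendsto τ (nhdsWithin 0 (Ioi 0)) (nhds (τ 0)) :=
    ((h.continuousOn 0 (by simp)).mono Ioi_subset_Ici_self)
  have hc2 : Filter.Tendsto (fun t => ‖τ t‖ₑ + ∫⁻ r in Set.Ioc 0 s, ‖deriv τ r‖ₑ)
      (nhdsWithin 0 (Ioi 0)) (nhds (‖τ 0‖ₑ + ∫⁻ r in Set.Ioc 0 s, ‖deriv τ r‖ₑ)) :=
    hc.enorm.add tendsto_const_nhds
  rw [h0, enorm_zero, zero_add] at hc2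
  refine ge_of_tendsto hc2 ?_
  filter_upwards [Ioo_mem_nhdsGT hs] with t ht
  refine (ftc hS hs ht.1).trans ?_
  gcongr
  rw [uIoc_of_le ht.2.le]
  exact Ioc_subset_Ioc_left ht.1.le

lemma tau_inf {τ : ℝ → ℝ} (h : ContDiffOn ℝ (⊤ : ℕ∞) τ (Set.Ici 0)) (h0 : τ 0 = 0) (M : ℝ≥0∞)
    (hM : ∀ s ∈ Ioo (0:ℝ) 1, ENNReal.ofReal (s ^ (0:ℝ) * |deriv τ s|) ≤ M) :
    ∀ s ∈ Ioo (0:ℝ) 1, ENNReal.ofReal (s ^ (-1:ℝ) * |τ s|) ≤ M := by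
  intro s hs
  have h1 : ‖τ s‖ₑ ≤ M * ENNReal.ofReal s := by
    refine (tau_int h h0 hs.1).trans ?_
    calc _ ≤ ∫⁻ r in Set.Ioc 0 s, M := by
          apply setLIntegral_mono' measurableSet_Ioc
          intro r hr
          have := hM r ⟨hr.1, hr.2.trans_lt hs.2⟩
          rwa [Real.rpow_zero, one_mul, ← Real.enorm_eq_ofReal_abs] at this
      _ = _ := by rw [setLIntegral_const, Real.volume_Ioc, sub_zero]
  rw [ENNReal.ofReal_mul (Real.rpow_nonneg hs.1.le _), ← Real.enorm_eq_ofReal_abs]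
  calc _ ≤ ENNReal.ofReal (s ^ (-1:ℝ)) * (M * ENNReal.ofReal s) := by gcongr
    _ = M * ENNReal.ofReal (s ^ (-1:ℝ) * s) := by
        rw [ENNReal.ofReal_mul (Real.rpow_nonneg hs.1.le _)]; ring
    _ = M := by
        rw [Real.rpow_neg_one, inv_mul_cancel₀ hs.1.ne']; simp

lemma tau_L2 {τ : ℝ → ℝ} (h : ContDiffOn ℝ (⊤ : ℕ∞) τ (Set.Ici 0)) (h0 : τ 0 = 0) :
    ∀ s ∈ Ioo (0:ℝ) 1, ENNReal.ofReal (s ^ (-1/2:ℝ) * |τ s|) ≤ wL2 0 (deriv τ) := by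
  intro s hs
  have hS : Sm τ := h.mono Ioi_subset_Ici_self
  have hsub : Ioc 0 s ⊆ Ioo 0 1 := fun x hx => ⟨hx.1, hx.2.trans_lt hs.2⟩
  have h1 : ‖τ s‖ₑ ≤ ENNReal.ofReal s ^ ((1:ℝ)/2) * wL2 0 (deriv τ) := by
    refine (tau_int h h0 hs.1).trans ?_
    have m2 : AEMeasurable (fun r : ℝ => ‖deriv τ r‖ₑ) (volume.restrict (Ioc 0 s)) :=
      (hS.deriv.aem.mono_measure (Measure.restrict_mono hsub le_rfl)).enorm
    have H := ENNReal.lintegral_mul_le_Lp_mul_Lq (volume.restrict (Ioc 0 s))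
      Real.HolderConjugate.two_two (f := fun _ => 1) aemeasurable_const m2
    refine le_trans (le_of_eq ?_) (H.trans ?_)
    · simp
    · rw [wL2_eq]
      simp only [ENNReal.one_rpow, Real.rpow_zero, ENNReal.ofReal_one, one_mul]
      refine mul_le_mul' ?_ ?_
      · simp
      · refine ENNReal.rpow_le_rpow (lintegral_mono_set hsub) (by norm_num)
  rw [ENNReal.ofReal_mul (Real.rpow_nonneg hs.1.le _), ← Real.enorm_eq_ofReal_abs]
  calc _ ≤ ENNReal.ofReal (s ^ (-1/2:ℝ)) * (ENNReal.ofReal s ^ ((1:ℝ)/2) * wL2 0 (deriv τ)) := by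
        gcongr
    _ = ENNReal.ofReal (s ^ (-1/2:ℝ) * s ^ ((1:ℝ)/2)) * wL2 0 (deriv τ) := by
        rw [ENNReal.ofReal_mul (Real.rpow_nonneg hs.1.le _),
          ENNReal.ofReal_rpow_of_nonneg hs.1.le (by norm_num)]; ring
    _ = _ := by
        rw [← Real.rpow_add hs.1]; norm_num

lemma XnormSq_eq (m : ℕ) (v : ℝ → ℝ) : XnormSq m v =
    ∑ i ∈ Finset.range (m + 1), wL2 (max 0 ((i:ℝ) - m / 2)) (iteratedDeriv i v) ^ 2 := by
  unfold XnormSq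
  obtain ⟨k, rfl | rfl⟩ := Nat.even_or_odd' m
  · rw [if_pos (by omega), show 2 * k / 2 = k by omega, show 2 * k + 1 = (k + 1) + k by ring,
      Finset.sum_range_add _ (k+1) k]
    congr 1
    · refine Finset.sum_congr rfl fun i hi => ?_
      have : (i:ℝ) ≤ k := by exact_mod_cast Nat.lt_succ_iff.1 (Finset.mem_range.1 hi)
      rw [max_eq_left (by push_cast; linarith)]
    · refine Finset.sum_congr rfl fun i hi => ?_
      rw [max_eq_right (by push_cast; have : (0:ℝ) ≤ i := by positivity
                           linarith), show k + i + 1 = k + 1 + i by ring]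
      congr 2; push_cast; ring
  · rw [if_neg (by omega), show (2 * k + 1) / 2 = k by omega,
      show 2 * k + 1 + 1 = (k + 1) + (k + 1) by ring, Finset.sum_range_add _ (k+1) (k+1)]
    congr 1
    · refine Finset.sum_congr rfl fun i hi => ?_
      have : (i:ℝ) ≤ k := by exact_mod_cast Nat.lt_succ_iff.1 (Finset.mem_range.1 hi)
      rw [max_eq_left (by push_cast; linarith)]
    · refine Finset.sum_congr rfl fun i hi => ?_
      rw [max_eq_right (by push_cast; have : (0:ℝ) ≤ i := by positivity
                           linarith), show k + i + 1 = k + 1 + i by ring]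
      congr 2; push_cast; ring

lemma YnormSq_eq (m : ℕ) (v : ℝ → ℝ) : YnormSq m v =
    ∑ i ∈ Finset.range (m + 1), wL2 (max 0 ((i:ℝ) - (m - 1) / 2)) (iteratedDeriv i v) ^ 2 := by
  unfold YnormSq
  obtain ⟨k, rfl | rfl⟩ := Nat.even_or_odd' m
  · rw [if_pos (by omega), show 2 * k / 2 = k by omega, show 2 * k + 1 = k + (k + 1) by ring,
      Finset.sum_range_add _ k (k+1)]
    congr 1
    · refine Finset.sum_congr rfl fun i hi => ?_
      have : (i:ℝ) + 1 ≤ k := by exact_mod_cast (Finset.mem_range.1 hi)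
      rw [max_eq_left (by push_cast; linarith)]
    · refine Finset.sum_congr rfl fun i hi => ?_
      rw [max_eq_right (by push_cast; have : (0:ℝ) ≤ i := by positivity
                           linarith)]
      congr 2; push_cast; ring
  · rw [if_neg (by omega), show (2 * k + 1) / 2 = k by omega,
      show 2 * k + 1 + 1 = (k + 1) + (k + 1) by ring, Finset.sum_range_add _ (k+1) (k+1)]
    congr 1
    · refine Finset.sum_congr rfl fun i hi => ?_
      have : (i:ℝ) ≤ k := by exact_mod_cast Nat.lt_succ_iff.1 (Finset.mem_range.1 hi)
      rw [max_eq_left (by push_cast; linarith)]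
    · refine Finset.sum_congr rfl fun i hi => ?_
      rw [max_eq_right (by push_cast; have : (0:ℝ) ≤ i := by positivity
                           linarith), show k + i + 1 = k + 1 + i by ring]
      congr 2; push_cast; ring

lemma sq_half (x : ℝ≥0∞) : (x ^ 2) ^ ((1:ℝ)/2) = x := by
  rw [← ENNReal.rpow_two, ← ENNReal.rpow_mul]; norm_num

lemma le_X {m i : ℕ} (hi : i ≤ m) (v : ℝ → ℝ) {α : ℝ} (hα : α = max 0 ((i:ℝ) - m / 2)) :
    wL2 α (iteratedDeriv i v) ≤ Xnorm m v := by
  unfold Xnorm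
  rw [XnormSq_eq, ← sq_half (wL2 α (iteratedDeriv i v)), hα]
  apply ENNReal.rpow_le_rpow _ (by norm_num)
  exact Finset.single_le_sum
    (f := fun i : ℕ => wL2 (max 0 ((i:ℝ) - m / 2)) (iteratedDeriv i v) ^ 2)
    (fun _ _ => zero_le) (Finset.mem_range.2 (Nat.lt_succ_of_le hi))

lemma le_Y {m i : ℕ} (hi : i ≤ m) (v : ℝ → ℝ) {α : ℝ} (hα : α = max 0 ((i:ℝ) - (m - 1) / 2)) :
    wL2 α (iteratedDeriv i v) ≤ Ynorm m v := by
  unfold Ynorm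
  rw [YnormSq_eq, ← sq_half (wL2 α (iteratedDeriv i v)), hα]
  apply ENNReal.rpow_le_rpow _ (by norm_num)
  exact Finset.single_le_sum
    (f := fun i : ℕ => wL2 (max 0 ((i:ℝ) - (m - 1) / 2)) (iteratedDeriv i v) ^ 2)
    (fun _ _ => zero_le) (Finset.mem_range.2 (Nat.lt_succ_of_le hi))

lemma sum_sq_le (F : Finset ℕ) (x : ℕ → ℝ≥0∞) : ∑ i ∈ F, x i ^ 2 ≤ (∑ i ∈ F, x i) ^ 2 := by
  rw [pow_two, Finset.sum_mul]
  refine Finset.sum_le_sum fun i hi => ?_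
  rw [pow_two]
  gcongr
  exact Finset.single_le_sum (f := x) (fun _ _ => zero_le) hi

lemma Y_le (m : ℕ) (v : ℝ → ℝ) : Ynorm m v ≤
    ∑ i ∈ Finset.range (m + 1), wL2 (max 0 ((i:ℝ) - (m - 1) / 2)) (iteratedDeriv i v) := by
  unfold Ynorm
  rw [YnormSq_eq]
  exact (ENNReal.rpow_le_rpow (z := 1/2) (sum_sq_le _ _) (by norm_num)).trans (sq_half _).le

/-- Leibniz reduction -/
lemma leibniz (δ : ℝ) (n : ℕ) (B : (ℝ → ℝ) → (ℝ → ℝ) → ℝ≥0∞)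
    (H : ∀ p q : ℕ, p + q = n → ∃ C : NNReal, ∀ τ u : ℝ → ℝ,
      ContDiffOn ℝ (⊤ : ℕ∞) τ (Set.Ici 0) → τ 0 = 0 → Sm u →
      wL2 δ (fun s => iteratedDeriv p τ s * iteratedDeriv q u s) ≤ C * B τ u) :
    ∃ C : NNReal, ∀ τ u : ℝ → ℝ,
      ContDiffOn ℝ (⊤ : ℕ∞) τ (Set.Ici 0) → τ 0 = 0 → Sm u →
      wL2 δ (iteratedDeriv n (fun s => τ s * u s)) ≤ C * B τ u := by
  have H' : ∀ p : ℕ, ∃ C : NNReal, p ∈ Finset.range (n + 1) → ∀ τ u : ℝ → ℝ,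
      ContDiffOn ℝ (⊤ : ℕ∞) τ (Set.Ici 0) → τ 0 = 0 → Sm u →
      wL2 δ (fun s => iteratedDeriv p τ s * iteratedDeriv (n - p) u s) ≤ C * B τ u := by
    intro p
    by_cases hp : p ≤ n
    · obtain ⟨C, hC⟩ := H p (n - p) (by omega)
      exact ⟨C, fun _ => hC⟩
    · exact ⟨0, fun h => absurd (Nat.lt_succ_iff.1 (Finset.mem_range.1 h)) hp⟩
  choose C hC using H'
  refine ⟨∑ p ∈ Finset.range (n + 1), (n.choose p : NNReal) * C p, fun τ u h h0 hu => ?_⟩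
  have hS : Sm τ := h.mono Ioi_subset_Ici_self
  have e : ∀ s ∈ Ioo (0:ℝ) 1, iteratedDeriv n (fun s => τ s * u s) s =
      ∑ p ∈ Finset.range (n + 1), (n.choose p : ℝ) * 
        (iteratedDeriv p τ s * iteratedDeriv (n - p) u s) := by
    intro s hs
    have h1 : ContDiffAt ℝ n τ s := (hS.cda hs.1).of_le (by exact_mod_cast le_top)
    have h2 : ContDiffAt ℝ n u s := (hu.cda hs.1).of_le (by exact_mod_cast le_top)
    have := iteratedDeriv_fun_mul h1 h2
    rw [this]
    exact Finset.sum_congr rfl fun p _ => by ring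
  rw [wL2_congr δ e]
  refine (wL2_sum δ _ (fun p => (n.choose p : ℝ))
    (fun p s => iteratedDeriv p τ s * iteratedDeriv (n - p) u s)
    (fun p _ => ((hS.iter p).mul (hu.iter _)).aem)).trans ?_
  push_cast
  rw [Finset.sum_mul]
  refine Finset.sum_le_sum fun p hp => ?_
  rw [mul_assoc, Nat.abs_cast, ENNReal.ofReal_natCast]
  gcongr
  exact hC p hp τ u h h0 hu

lemma iter_deriv (p : ℕ) (f : ℝ → ℝ) : deriv (iteratedDeriv p f) = iteratedDeriv (p + 1) f :=
  iteratedDeriv_succ.symm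

lemma X_tau {M p : ℕ} (hp : 1 ≤ p) (hM : p ≤ M + 1) (τ : ℝ → ℝ) {α : ℝ}
    (hα : α = max 0 ((p:ℝ) - 1 - M / 2)) :
    wL2 α (iteratedDeriv p τ) ≤ Xnorm M (deriv τ) := by
  obtain ⟨k, rfl⟩ : ∃ k, p = k + 1 := ⟨p - 1, by omega⟩
  rw [iteratedDeriv_succ']
  refine le_X (by omega) _ ?_
  rw [hα]; push_cast; congr 1; ring

abbrev TermB (δ : ℝ) (p q : ℕ) (B : (ℝ → ℝ) → (ℝ → ℝ) → ℝ≥0∞) : Prop :=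
  ∃ C : NNReal, ∀ τ u : ℝ → ℝ,
      ContDiffOn ℝ (⊤ : ℕ∞) τ (Set.Ici 0) → τ 0 = 0 → Sm u →
      wL2 δ (fun s => iteratedDeriv p τ s * iteratedDeriv q u s) ≤ C * B τ u

lemma term_pos (m l p q : ℕ) (hm : 1 ≤ m) (hl : l ≤ m) (hpq : p + q = l + 2) :
    TermB (max 0 ((l:ℝ) - (m - 1) / 2)) p q
      (fun τ u => Xnorm (m + 1) (deriv τ) * Ynorm (m + 2) u) := by
  have hpqr : (p:ℝ) + q = l + 2 := by exact_mod_cast hpq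
  have hlr : (l:ℝ) ≤ m := by exact_mod_cast hl
  have hmr : (1:ℝ) ≤ m := by exact_mod_cast hm
  have l0 : (0:ℝ) ≤ l := by positivity
  have q0 : (0:ℝ) ≤ q := by positivity
  by_cases hp : 2 * p ≤ m + 1
  · obtain ⟨C, hC⟩ := emb 0 0 0 le_rfl le_rfl (by norm_num)
    refine ⟨C * 2, fun τ u h h0 hu => ?_⟩
    have hS : Sm τ := h.mono Ioi_subset_Ici_self
    have sup : ∀ p' : ℕ, 1 ≤ p' → 2 * p' ≤ m + 1 → ∀ s ∈ Ioo (0:ℝ) 1,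
        ENNReal.ofReal (s ^ (0:ℝ) * |iteratedDeriv p' τ s|) ≤ C * 2 * Xnorm (m + 1) (deriv τ) := by
      intro p' h1 h2 s hs
      have h2r : 2 * (p':ℝ) ≤ m + 1 := by exact_mod_cast h2
      refine (hC _ (hS.iter p') s hs).trans ?_
      rw [mul_assoc, two_mul, iter_deriv]
      gcongr
      · exact X_tau h1 (by omega) τ (by rw [max_eq_left]; push_cast; linarith)
      · exact X_tau (by omega) (by omega) τ (by rw [max_eq_left]; push_cast; linarith)
    rw [← mul_assoc]
    push_cast
    rcases Nat.eq_zero_or_pos p with rfl | hp1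
    · have s1 : ∀ s ∈ Ioo (0:ℝ) 1, ENNReal.ofReal (s ^ (-1:ℝ) * |iteratedDeriv 0 τ s|) ≤
          C * 2 * Xnorm (m + 1) (deriv τ) := by
        rw [iteratedDeriv_zero]
        apply tau_inf h h0
        have := sup 1 le_rfl (by omega)
        rwa [iteratedDeriv_one] at this
      refine (wL2_mul_le (α := max 0 ((q:ℝ) - ((m + 2 : ℕ) - 1) / 2)) ?_ (hu.iter q).aem _ s1).trans ?_
      · push_cast at *
        rcases max_cases 0 ((l:ℝ) - (m - 1) / 2) with ⟨h, _⟩ | ⟨h, _⟩ <;>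
        rcases max_cases 0 ((q:ℝ) - ((m + 2) - 1) / 2) with ⟨h', _⟩ | ⟨h', _⟩ <;>
        rw [h, h'] <;> linarith
      · gcongr
        exact le_Y (by omega) u rfl
    · have p1 : (1:ℝ) ≤ p := by exact_mod_cast hp1
      refine (wL2_mul_le (α := max 0 ((q:ℝ) - ((m + 2 : ℕ) - 1) / 2)) ?_ (hu.iter q).aem _
        (sup p hp1 hp)).trans ?_
      · rw [add_zero]
        apply max_le_max le_rfl
        push_cast; linarith
      · gcongr
        exact le_Y (by omega) u rfl
  · set δ := max 0 ((l:ℝ) - (m - 1) / 2) with hδ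
    set β := max 0 ((p:ℝ) - 1 - (m + 1 : ℕ) / 2) with hβ
    set α := max 0 ((q:ℝ) - ((m + 2 : ℕ) - 1) / 2) with hα
    set κ := max 0 (((q + 1 : ℕ):ℝ) - ((m + 2 : ℕ) - 1) / 2) with hκ
    have key : 0 ≤ δ - β ∧ κ - 1/2 < δ - β := by
      push_cast at hδ hβ hα hκ
      by_cases h3 : m + 3 ≤ 2 * p
      · have h3r : (m:ℝ) + 3 ≤ 2 * p := by exact_mod_cast h3
        have plr : (p:ℝ) ≤ l + 2 := by linarith
        rw [max_eq_right (by linarith)] at hδ hβ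
        rcases max_cases 0 ((q:ℝ) + 1 - ((m + 2) - 1) / 2) with ⟨h, _⟩ | ⟨h, _⟩ <;>
        rw [h] at hκ <;> constructor <;> linarith
      · have h3r : (m:ℝ) + 2 = 2 * p := by exact_mod_cast (by omega : m + 2 = 2 * p)
        have h4r : (2:ℝ) ≤ m := by exact_mod_cast (by omega : 2 ≤ m)
        rw [max_eq_left (by linarith)] at hβ
        rcases max_cases 0 ((l:ℝ) - (m - 1) / 2) with ⟨h, _⟩ | ⟨h, _⟩ <;>
        rcases max_cases 0 ((q:ℝ) + 1 - ((m + 2) - 1) / 2) with ⟨h', _⟩ | ⟨h', _⟩ <;>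
        rw [h] at hδ <;> rw [h'] at hκ <;> constructor <;> linarith
    obtain ⟨C, hC⟩ := emb α κ (δ - β) (le_max_left _ _) key.1 key.2
    refine ⟨C * 2, fun τ u h h0 hu => ?_⟩
    have hS : Sm τ := h.mono Ioi_subset_Ici_self
    have sup : ∀ s ∈ Ioo (0:ℝ) 1,
        ENNReal.ofReal (s ^ (δ - β) * |iteratedDeriv q u s|) ≤ C * 2 * Ynorm (m + 2) u := by
      intro s hs
      refine (hC _ (hu.iter q) s hs).trans ?_
      rw [mul_assoc, two_mul, iter_deriv]
      gcongr
      · exact le_Y (by omega) u rfl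
      · exact le_Y (by omega) u rfl
    have := wL2_mul_le (α := β) (δ := δ) (by linarith) (hS.iter p).aem _ sup
    simp only [mul_comm (iteratedDeriv p τ _)]
    refine this.trans ?_
    push_cast
    rw [mul_comm (Xnorm _ _), ← mul_assoc]
    gcongr
    exact X_tau (by omega) (by omega) τ rfl

lemma term_zero (p q : ℕ) (hpq : p + q = 2) :
    TermB (1/2) p q (fun τ u => Xnorm 1 (deriv τ) * Ynorm 3 u) := by
  obtain ⟨rfl, rfl⟩ | ⟨rfl, rfl⟩ | ⟨rfl, rfl⟩ :
      (p = 0 ∧ q = 2) ∨ (p = 1 ∧ q = 1) ∨ (p = 2 ∧ q = 0) := by omega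
  · refine ⟨1, fun τ u h h0 hu => ?_⟩
    refine (wL2_mul_le (α := 1) (β := -1/2) (by norm_num) (hu.iter 2).aem (wL2 0 (deriv τ)) ?_).trans ?_
    · rw [iteratedDeriv_zero]; exact tau_L2 h h0
    · rw [ENNReal.coe_one, one_mul]
      beta_reduce
      gcongr
      · have := X_tau (M := 1) (p := 1) le_rfl (by norm_num) τ (α := 0) (by norm_num)
        rwa [iteratedDeriv_one] at this
      · exact le_Y (by norm_num) u (by norm_num)
  · obtain ⟨C, hC⟩ := emb 0 (1/2) (1/2) le_rfl (by norm_num) (by norm_num)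
    refine ⟨C * 2, fun τ u h h0 hu => ?_⟩
    have hS : Sm τ := h.mono Ioi_subset_Ici_self
    refine (wL2_mul_le (α := 0) (β := 1/2) (by norm_num) (hu.iter 1).aem
      (C * 2 * Xnorm 1 (deriv τ)) ?_).trans ?_
    · intro s hs
      refine (hC _ (hS.iter 1) s hs).trans ?_
      rw [mul_assoc, two_mul, iter_deriv]
      gcongr
      · exact X_tau (by norm_num) (by norm_num) τ (by norm_num)
      · exact X_tau (by norm_num) (by norm_num) τ (by norm_num)
    · push_cast
      rw [← mul_assoc]
      gcongr
      exact le_Y (by norm_num) u (by norm_num)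
  · obtain ⟨C, hC⟩ := emb 0 0 0 le_rfl (by norm_num) (by norm_num)
    refine ⟨C * 2, fun τ u h h0 hu => ?_⟩
    have hS : Sm τ := h.mono Ioi_subset_Ici_self
    simp only [mul_comm (iteratedDeriv 2 τ _)]
    refine (wL2_mul_le (α := 1/2) (β := 0) (by norm_num) (hS.iter 2).aem
      (C * 2 * Ynorm 3 u) ?_).trans ?_
    · intro s hs
      refine (hC _ (hu.iter 0) s hs).trans ?_
      rw [mul_assoc, two_mul, iter_deriv]
      gcongr
      · exact le_Y (by norm_num) u (by norm_num)
      · exact le_Y (by norm_num) u (by norm_num)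
    · push_cast
      rw [mul_comm (Xnorm _ _), ← mul_assoc]
      gcongr
      exact X_tau (by norm_num) (by norm_num) τ (by norm_num)

lemma term_eps (ε : ℝ) (hε : 0 < ε) (p q : ℕ) (hpq : p + q = 2) :
    TermB (1/2 + ε) p q
      (fun τ u => (wLinf 0 (deriv τ) + wL2 (1/2) (iteratedDeriv 2 τ)) * Ynorm 2 u) := by
  have inf : ∀ τ : ℝ → ℝ, ∀ s ∈ Ioo (0:ℝ) 1,
      ENNReal.ofReal (s ^ (0:ℝ) * |deriv τ s|) ≤ wLinf 0 (deriv τ) := by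
    intro τ s hs
    exact le_iSup (fun s : Set.Ioo (0:ℝ) 1 => ENNReal.ofReal ((s : ℝ) ^ (0:ℝ) * ‖deriv τ (s : ℝ)‖))
      ⟨s, hs⟩
  obtain ⟨rfl, rfl⟩ | ⟨rfl, rfl⟩ | ⟨rfl, rfl⟩ :
      (p = 0 ∧ q = 2) ∨ (p = 1 ∧ q = 1) ∨ (p = 2 ∧ q = 0) := by omega
  · refine ⟨1, fun τ u h h0 hu => ?_⟩
    refine (wL2_mul_le (α := 3/2) (β := -1) (by linarith) (hu.iter 2).aem
      (wLinf 0 (deriv τ)) ?_).trans ?_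
    · rw [iteratedDeriv_zero]; exact tau_inf h h0 _ (inf τ)
    · rw [ENNReal.coe_one, one_mul]
      beta_reduce
      gcongr
      · exact le_self_add
      · exact le_Y (by norm_num) u (by norm_num)
  · refine ⟨1, fun τ u h h0 hu => ?_⟩
    refine (wL2_mul_le (α := 1/2) (β := 0) (by linarith) (hu.iter 1).aem
      (wLinf 0 (deriv τ)) ?_).trans ?_
    · rw [iteratedDeriv_one]; exact inf τ
    · rw [ENNReal.coe_one, one_mul]
      beta_reduce
      gcongr
      · exact le_self_add
      · exact le_Y (by norm_num) u (by norm_num)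
  · obtain ⟨C, hC⟩ := emb 0 (1/2) ε le_rfl hε.le (by linarith)
    refine ⟨C * 2, fun τ u h h0 hu => ?_⟩
    have hS : Sm τ := h.mono Ioi_subset_Ici_self
    simp only [mul_comm (iteratedDeriv 2 τ _)]
    refine (wL2_mul_le (α := 1/2) (β := ε) le_rfl (hS.iter 2).aem
      (C * 2 * Ynorm 2 u) ?_).trans ?_
    · intro s hs
      refine (hC _ (hu.iter 0) s hs).trans ?_
      rw [mul_assoc, two_mul, iter_deriv]
      gcongr
      · exact le_Y (by norm_num) u (by norm_num)
      · exact le_Y (by norm_num) u (by norm_num)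
    · push_cast
      rw [mul_comm (wLinf _ _ + _), ← mul_assoc]
      gcongr
      exact le_add_self

lemma fin_const {a b : ℝ≥0∞} {C : NNReal} (h : a ≤ C * b) :
    a ≤ ENNReal.ofReal ((C:ℝ) + 1) * b := by
  refine h.trans ?_
  gcongr
  rw [← ENNReal.ofReal_coe_nnreal]
  exact ENNReal.ofReal_le_ofReal (by linarith)

lemma part1 (m : ℕ) : ∃ C : NNReal, ∀ τ u : ℝ → ℝ,
      ContDiffOn ℝ (⊤ : ℕ∞) τ (Set.Ici 0) → τ 0 = 0 → Sm u →
      Ynorm m (iteratedDeriv 2 (fun s => τ s * u s)) ≤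
        C * (Xnorm (m + 1) (deriv τ) * Ynorm (max (m + 2) 3) u) := by
  have H : ∀ l : ℕ, ∃ C : NNReal, l ∈ Finset.range (m + 1) → ∀ τ u : ℝ → ℝ,
      ContDiffOn ℝ (⊤ : ℕ∞) τ (Set.Ici 0) → τ 0 = 0 → Sm u →
      wL2 (max 0 ((l:ℝ) - (m - 1) / 2)) (iteratedDeriv (l + 2) (fun s => τ s * u s)) ≤
        C * (Xnorm (m + 1) (deriv τ) * Ynorm (max (m + 2) 3) u) := by
    intro l
    by_cases hl : l ≤ m
    · obtain ⟨C, hC⟩ := leibniz (max 0 ((l:ℝ) - (m - 1) / 2)) (l + 2)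
        (fun τ u => Xnorm (m + 1) (deriv τ) * Ynorm (max (m + 2) 3) u) (by
          intro p q hpq
          rcases Nat.eq_zero_or_pos m with rfl | hm
          · obtain rfl : l = 0 := by omega
            have := term_zero p q hpq
            norm_num at this ⊢
            exact this
          · rw [max_eq_left (by omega : 3 ≤ m + 2)]
            exact term_pos m l p q hm hl hpq)
      exact ⟨C, fun _ => hC⟩
    · exact ⟨0, fun h => absurd (Nat.lt_succ_iff.1 (Finset.mem_range.1 h)) hl⟩
  choose C hC using H
  refine ⟨∑ l ∈ Finset.range (m + 1), C l, fun τ u h h0 hu => ?_⟩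
  refine (Y_le m _).trans ?_
  push_cast
  rw [Finset.sum_mul]
  refine Finset.sum_le_sum fun l hl => ?_
  have e : iteratedDeriv l (iteratedDeriv 2 (fun s => τ s * u s)) =
      iteratedDeriv (l + 2) (fun s => τ s * u s) := by
    simp only [iteratedDeriv_eq_iterate, Function.iterate_add_apply]
  rw [e]
  exact hC l hl τ u h h0 hu

lemma part2 (ε : ℝ) (hε : 0 < ε) : ∃ C : NNReal, ∀ τ u : ℝ → ℝ,
      ContDiffOn ℝ (⊤ : ℕ∞) τ (Set.Ici 0) → τ 0 = 0 → Sm u →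
      wL2 (1/2 + ε) (iteratedDeriv 2 (fun s => τ s * u s)) ≤
        C * ((wLinf 0 (deriv τ) + wL2 (1/2) (iteratedDeriv 2 τ)) * Ynorm 2 u) :=
  leibniz (1/2 + ε) 2
    (fun τ u => (wLinf 0 (deriv τ) + wL2 (1/2) (iteratedDeriv 2 τ)) * Ynorm 2 u)
    (fun p q hpq => term_eps ε hε p q hpq)

end Aux

/-- estimates for `‖(τ u)''‖_{Y^m}` and `‖s^ε (τ u)''‖_{Y^0}` when `τ(0) = 0`.
Note that `‖s^ε w‖_{Y^0} = (∫₀¹ s^{1+2ε} |w|²)^{1/2} = ‖s^{1/2+ε} w‖_{L²}`, and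
`‖τ''‖_{Y^0} = ‖s^{1/2} τ''‖_{L²}`. -/
theorem stmt10 :
    (∀ m : ℕ, ∃ C : ℝ, 0 < C ∧ ∀ τ u : ℝ → ℝ,
      ContDiffOn ℝ (⊤ : ℕ∞) τ (Set.Ici 0) → τ 0 = 0 →
      ContDiffOn ℝ (⊤ : ℕ∞) u (Set.Ioi 0) →
      Ynorm m (iteratedDeriv 2 (fun s => τ s * u s)) ≤
        ENNReal.ofReal C * (Xnorm (m + 1) (deriv τ) * Ynorm (max (m + 2) 3) u)) ∧
    (∀ ε : ℝ, 0 < ε → ∃ C : ℝ, 0 < C ∧ ∀ τ u : ℝ → ℝ,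
      ContDiffOn ℝ (⊤ : ℕ∞) τ (Set.Ici 0) → τ 0 = 0 →
      ContDiffOn ℝ (⊤ : ℕ∞) u (Set.Ioi 0) →
      wL2 (1/2 + ε) (iteratedDeriv 2 (fun s => τ s * u s)) ≤
        ENNReal.ofReal C *
          ((wLinf 0 (deriv τ) + wL2 (1/2) (iteratedDeriv 2 τ)) * Ynorm 2 u)) := by
  refine ⟨fun m => ?_, fun ε hε => ?_⟩
  · obtain ⟨C, hC⟩ := Aux.part1 m
    exact ⟨C + 1, by positivity, fun τ u h h0 hu => Aux.fin_const (hC τ u h h0 hu)⟩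
  · obtain ⟨C, hC⟩ := Aux.part2 ε hε
    exact ⟨C + 1, by positivity, fun τ u h h0 hu => Aux.fin_const (hC τ u h h0 hu)⟩
end
end

section
/- For every M > 0 and every integer m ≥ 1 there exists a constant C = C(M, m) > 0 with the following property: if u : (0,1] → ℝ³ is sufficiently smooth with ‖u‖_{Y^{max(m,3)}} ≤ M, h is a sufficiently smooth function on (0,1] with finite Y^{m-1} norm, a ∈ ℝ, and τ ∈ C²([0,1]) satisfies the two-point boundary value problem -τ''(s) + |u'(s)|² τ(s) = h(s) for all s ∈ (0,1), τ(0) = 0, and τ'(1) = a, then ‖τ'‖_{X^m} ≤ C ( |a| + ‖h‖_{Y^{m-1}} ). -/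
open MeasureTheory ENNReal RealInnerProductSpace

noncomputable section

def L2B {E : Type*} [NormedAddCommGroup E] (α : ℝ) (w : ℝ → E) (K : ℝ) : Prop :=
  ∫⁻ s in Set.Ioo (0:ℝ) 1, ENNReal.ofReal (s ^ (2 * α) * ‖w s‖ ^ 2) ≤ ENNReal.ofReal (K ^ 2)

theorem L2B_of_le {E F : Type*} [NormedAddCommGroup E] [NormedAddCommGroup F]
    {α β δ c K : ℝ} {f : ℝ → E} {g : ℝ → F} (hc : 0 ≤ c)
    (hfg : ∀ s ∈ Set.Ioo (0:ℝ) 1, ‖f s‖ ≤ c * s ^ (-δ) * ‖g s‖)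
    (hg : L2B α g K) (hab : α + δ ≤ β) : L2B β f (c * K) := by
  unfold L2B at *
  calc ∫⁻ s in Set.Ioo (0:ℝ) 1, ENNReal.ofReal (s ^ (2 * β) * ‖f s‖ ^ 2)
      ≤ ∫⁻ s in Set.Ioo (0:ℝ) 1, ENNReal.ofReal (c ^ 2) *
          ENNReal.ofReal (s ^ (2 * α) * ‖g s‖ ^ 2) := by
        refine setLIntegral_mono' measurableSet_Ioo fun s hs => ?_
        rw [← ENNReal.ofReal_mul (by positivity)]
        apply ENNReal.ofReal_le_ofReal
        have hs0 : 0 < s := hs.1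
        have h1 : ‖f s‖ ^ 2 ≤ (c * s ^ (-δ) * ‖g s‖) ^ 2 :=
          pow_le_pow_left₀ (norm_nonneg _) (hfg s hs) 2
        have h2 : s ^ (2 * β) ≤ s ^ (2 * α + 2 * δ) :=
          Real.rpow_le_rpow_of_exponent_ge hs0 hs.2.le (by linarith)
        have h3 : s ^ (2 * α + 2 * δ) * (s ^ (-δ)) ^ 2 = s ^ (2 * α) := by
          rw [← Real.rpow_natCast, ← Real.rpow_mul hs0.le, ← Real.rpow_add hs0]
          congr 1; push_cast; ring
        calc s ^ (2 * β) * ‖f s‖ ^ 2 ≤ s ^ (2 * α + 2 * δ) * (c * s ^ (-δ) * ‖g s‖) ^ 2 := by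
              gcongr
          _ = c ^ 2 * ((s ^ (2 * α + 2 * δ) * (s ^ (-δ)) ^ 2) * ‖g s‖ ^ 2) := by ring
          _ = _ := by rw [h3]
    _ = ENNReal.ofReal (c ^ 2) * ∫⁻ s in Set.Ioo (0:ℝ) 1,
          ENNReal.ofReal (s ^ (2 * α) * ‖g s‖ ^ 2) := by
        rw [lintegral_const_mul' _ _ ENNReal.ofReal_ne_top]
    _ ≤ ENNReal.ofReal (c ^ 2) * ENNReal.ofReal (K ^ 2) := by gcongr
    _ = ENNReal.ofReal ((c * K) ^ 2) := by
        rw [← ENNReal.ofReal_mul (by positivity)]; congr 1; ring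

theorem L2B.mono {E : Type*} [NormedAddCommGroup E] {α β K : ℝ} {f : ℝ → E}
    (hf : L2B α f K) (h : α ≤ β) : L2B β f K := by
  have := L2B_of_le (f := f) (δ := 0) zero_le_one (fun s _ => by simp) hf
    (by linarith : α + 0 ≤ β)
  simpa using this

theorem L2B.mono_K {E : Type*} [NormedAddCommGroup E] {α K K' : ℝ} {f : ℝ → E}
    (hf : L2B α f K) (h0 : 0 ≤ K) (h : K ≤ K') : L2B α f K' := by
  unfold L2B at *
  exact hf.trans (ENNReal.ofReal_le_ofReal (by gcongr))

theorem aemeas_w {E : Type*} [NormedAddCommGroup E] {α : ℝ} {w : ℝ → E}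
    (hw : ContinuousOn w (Set.Ioo 0 1)) :
    AEMeasurable (fun s : ℝ => ENNReal.ofReal (s ^ (2 * α) * ‖w s‖ ^ 2))
      (volume.restrict (Set.Ioo (0:ℝ) 1)) := by
  refine ENNReal.measurable_ofReal.comp_aemeasurable ?_
  refine ContinuousOn.aemeasurable ?_ measurableSet_Ioo
  refine ContinuousOn.mul ?_ (hw.norm.pow 2)
  exact continuousOn_id.rpow_const fun x hx => Or.inl hx.1.ne'

theorem L2B_sum {E F ι : Type*} [NormedAddCommGroup E] [NormedAddCommGroup F]
    (A : Finset ι) {α : ℝ} {f : ℝ → E} {g : ι → ℝ → F} {K : ι → ℝ}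
    (hK : ∀ i ∈ A, 0 ≤ K i)
    (hc : ∀ i ∈ A, ContinuousOn (g i) (Set.Ioo 0 1))
    (hfg : ∀ s ∈ Set.Ioo (0:ℝ) 1, ‖f s‖ ≤ ∑ i ∈ A, ‖g i s‖)
    (hg : ∀ i ∈ A, L2B α (g i) (K i)) : L2B α f (A.card * ∑ i ∈ A, K i) := by
  have hS : ∀ i ∈ A, K i ≤ ∑ i ∈ A, K i := fun i hi => Finset.single_le_sum hK hi
  set S := ∑ i ∈ A, K i
  unfold L2B at *
  calc ∫⁻ s in Set.Ioo (0:ℝ) 1, ENNReal.ofReal (s ^ (2 * α) * ‖f s‖ ^ 2)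
      ≤ ∫⁻ s in Set.Ioo (0:ℝ) 1, ENNReal.ofReal A.card * 
          ∑ i ∈ A, ENNReal.ofReal (s ^ (2 * α) * ‖g i s‖ ^ 2) := by
        refine setLIntegral_mono' measurableSet_Ioo fun s hs => ?_
        have hs0 : 0 < s := hs.1
        rw [← ENNReal.ofReal_sum_of_nonneg (fun i _ => by positivity),
          ← ENNReal.ofReal_mul (by positivity)]
        apply ENNReal.ofReal_le_ofReal
        have h1 : ‖f s‖ ^ 2 ≤ (∑ i ∈ A, ‖g i s‖) ^ 2 :=
          pow_le_pow_left₀ (norm_nonneg _) (hfg s hs) 2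
        have h2 := h1.trans (sq_sum_le_card_mul_sum_sq (s := A) (f := fun i => ‖g i s‖))
        rw [← Finset.mul_sum]
        calc _ ≤ s ^ (2 * α) * (A.card * ∑ i ∈ A, ‖g i s‖ ^ 2) := by gcongr
          _ = _ := by ring
    _ = ENNReal.ofReal A.card * ∑ i ∈ A, ∫⁻ s in Set.Ioo (0:ℝ) 1,
          ENNReal.ofReal (s ^ (2 * α) * ‖g i s‖ ^ 2) := by
        rw [lintegral_const_mul' _ _ ENNReal.ofReal_ne_top, lintegral_finsetSum']
        exact fun i hi => aemeas_w (hc i hi)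
    _ ≤ ENNReal.ofReal A.card * ∑ i ∈ A, ENNReal.ofReal (S ^ 2) := by
        gcongr with i hi
        refine (hg i hi).trans (ENNReal.ofReal_le_ofReal ?_)
        exact pow_le_pow_left₀ (hK i hi) (hS i hi) 2
    _ = ENNReal.ofReal ((A.card * S) ^ 2) := by
        rw [Finset.sum_const, nsmul_eq_mul, ← ENNReal.ofReal_natCast,
          ← ENNReal.ofReal_mul (by positivity), ← ENNReal.ofReal_mul (by positivity)]
        congr 1; ring

theorem cs_diff {E : Type*} [NormedAddCommGroup E] [NormedSpace ℝ E] {γ K J x y : ℝ} {w : ℝ → E}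
    (hK : 0 ≤ K) (hJ : 0 ≤ J) (hx : 0 ≤ x) (hxy : x ≤ y) (hy : y ≤ 1)
    (hw : ContDiffOn ℝ 1 w (Set.Icc x y)) (hL : L2B γ (deriv w) K)
    (hI : ∫⁻ t in Set.Ioo x y, ENNReal.ofReal (t ^ (-(2 * γ))) ≤ ENNReal.ofReal (J ^ 2)) :
    ‖w y - w x‖ ≤ J * K := by
  have h1 := enorm_sub_le_lintegral_deriv_of_contDiffOn_Icc hw hxy
  rw [setLIntegral_congr (Ioo_ae_eq_Icc (μ := volume) (a := x) (b := y)).symm] at h1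
  have hcd : ContinuousOn (deriv w) (Set.Ioo x y) := by
    have := (contDiffOn_succ_iff_deriv_of_isOpen (n := 0) (isOpen_Ioo)).1
      (by simpa using hw.mono Set.Ioo_subset_Icc_self)
    exact this.2.2.continuousOn
  have h2 : ∫⁻ t in Set.Ioo x y, ‖deriv w t‖ₑ ≤
      ∫⁻ t in Set.Ioo x y, ((fun t : ℝ => ENNReal.ofReal (t ^ (-γ))) *
        (fun t : ℝ => ENNReal.ofReal (t ^ γ * ‖deriv w t‖))) t := by
    refine setLIntegral_mono' measurableSet_Ioo fun t ht => ?_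
    have ht0 : 0 < t := hx.trans_lt ht.1
    simp only [Pi.mul_apply]
    rw [← ENNReal.ofReal_mul (by positivity), ← mul_assoc, ← Real.rpow_add ht0]
    simp
  have hcpow : ∀ c : ℝ, ContinuousOn (fun t : ℝ => t ^ c) (Set.Ioo x y) := fun c =>
    continuousOn_id.rpow_const fun t ht => Or.inl (hx.trans_lt ht.1).ne'
  have h3 := ENNReal.lintegral_mul_le_Lp_mul_Lq (volume.restrict (Set.Ioo x y))
    Real.HolderConjugate.two_two (f := fun t : ℝ => ENNReal.ofReal (t ^ (-γ)))
    (g := fun t : ℝ => ENNReal.ofReal (t ^ γ * ‖deriv w t‖))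
    (ENNReal.measurable_ofReal.comp_aemeasurable ((hcpow _).aemeasurable measurableSet_Ioo))
    (ENNReal.measurable_ofReal.comp_aemeasurable
      (((hcpow _).mul hcd.norm).aemeasurable measurableSet_Ioo))
  have h4 : ∫⁻ t in Set.Ioo x y, ENNReal.ofReal (t ^ (-γ)) ^ (2:ℝ) ≤ ENNReal.ofReal (J ^ 2) := by
    refine le_trans (setLIntegral_mono' measurableSet_Ioo fun t ht => ?_) hI
    have ht0 : 0 < t := hx.trans_lt ht.1
    rw [ENNReal.ofReal_rpow_of_nonneg (by positivity) (by norm_num), ← Real.rpow_mul ht0.le]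
    apply le_of_eq; congr 2; ring
  have h5 : ∫⁻ t in Set.Ioo x y, ENNReal.ofReal (t ^ γ * ‖deriv w t‖) ^ (2:ℝ) ≤
      ENNReal.ofReal (K ^ 2) := by
    refine le_trans ?_ hL
    refine le_trans (setLIntegral_mono' (g := fun s => ENNReal.ofReal (s ^ (2 * γ) * ‖deriv w s‖ ^ 2))
      measurableSet_Ioo fun t ht => ?_) (lintegral_mono_set (Set.Ioo_subset_Ioo hx hy))
    have ht0 : 0 < t := hx.trans_lt ht.1
    rw [ENNReal.ofReal_rpow_of_nonneg (by positivity) (by norm_num),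
      Real.mul_rpow (by positivity) (by positivity), ← Real.rpow_mul ht0.le,
      Real.rpow_two, mul_comm γ 2]
  have hrt : ∀ a : ℝ, 0 ≤ a → ENNReal.ofReal (a ^ 2) ^ ((1:ℝ) / 2) = ENNReal.ofReal a := by
    intro a ha
    rw [ENNReal.ofReal_rpow_of_nonneg (by positivity) (by norm_num), ← Real.sqrt_eq_rpow,
      Real.sqrt_sq ha]
  have h6 : ‖w y - w x‖ₑ ≤ ENNReal.ofReal (J * K) := by
    refine h1.trans (h2.trans (h3.trans ?_))
    rw [ENNReal.ofReal_mul hJ, ← hrt J hJ, ← hrt K hK]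
    gcongr
  rw [← ofReal_norm] at h6
  exact (ENNReal.ofReal_le_ofReal_iff (by positivity)).1 h6

theorem lint_pow {S x y : ℝ} (hS : 0 < S) (hx : 0 < x) (hxy : x ≤ y) :
    ∫⁻ t in Set.Ioo x y, ENNReal.ofReal (t ^ (-(2 * (S + 1 / 2)))) ≤
      ENNReal.ofReal (x ^ (-(2 * S)) / (2 * S)) := by
  have hmeas : IntegrableOn (fun t : ℝ => t ^ (-(2 * (S + 1 / 2)))) (Set.Ioi x) :=
    integrableOn_Ioi_rpow_of_lt (by linarith) hx
  calc _ ≤ ∫⁻ t in Set.Ioi x, ENNReal.ofReal (t ^ (-(2 * (S + 1 / 2)))) :=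
        lintegral_mono_set Set.Ioo_subset_Ioi_self
    _ = ENNReal.ofReal (∫ t in Set.Ioi x, t ^ (-(2 * (S + 1 / 2)))) := by
        rw [ofReal_integral_eq_lintegral_ofReal hmeas]
        refine (ae_restrict_iff' measurableSet_Ioi).2 (Filter.Eventually.of_forall fun t ht => ?_)
        exact Real.rpow_nonneg (hx.le.trans (le_of_lt ht)) _
    _ = _ := by
        rw [integral_Ioi_rpow_of_lt (by linarith) hx]
        congr 1
        have : -(2 * (S + 1 / 2)) + 1 = -(2 * S) := by ring
        rw [this, div_neg, neg_div, neg_neg]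

theorem sup_bound {E : Type*} [NormedAddCommGroup E] [NormedSpace ℝ E] {S κ K : ℝ} {w : ℝ → E}
    (hS : 0 < S) (hκ : 0 ≤ κ) (hK : 0 ≤ K)
    (hw : ContDiffOn ℝ 1 w (Set.Ioo 0 1)) (h1 : L2B κ w K) (h2 : L2B (S + 1 / 2) (deriv w) K) :
    ∀ s ∈ Set.Ioo (0:ℝ) 1, ‖w s‖ ≤ (2 ^ (κ + 1) + 2 ^ S / √(2 * S)) * K * s ^ (-S) := by
  -- a good point
  obtain ⟨r, hr, hwr⟩ : ∃ r ∈ Set.Ioo (1/2:ℝ) 1, ‖w r‖ ≤ 2 ^ (κ + 1) * K := by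
    have hsub : Set.Ioo (1/2:ℝ) 1 ⊆ Set.Ioo 0 1 := Set.Ioo_subset_Ioo_left (by norm_num)
    obtain ⟨r, hr, hle⟩ := exists_le_setLAverage (μ := volume) (s := Set.Ioo (1/2:ℝ) 1)
      (f := fun s : ℝ => ENNReal.ofReal (s ^ (2 * κ) * ‖w s‖ ^ 2))
      (by simp; norm_num) (by simp)
      ((aemeas_w hw.continuousOn).mono_measure (Measure.restrict_mono hsub le_rfl))
    refine ⟨r, hr, ?_⟩
    rw [setLAverage_eq] at hle
    have h3 : ENNReal.ofReal (r ^ (2 * κ) * ‖w r‖ ^ 2) ≤ ENNReal.ofReal (2 * K ^ 2) := by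
      refine hle.trans ?_
      have h4 := (lintegral_mono_set (μ := volume) (f := fun s : ℝ =>
        ENNReal.ofReal (s ^ (2 * κ) * ‖w s‖ ^ 2)) hsub).trans h1
      rw [Real.volume_Ioo]
      calc _ ≤ ENNReal.ofReal (K ^ 2) / ENNReal.ofReal (1 - 1/2) := by gcongr
        _ = _ := by
          rw [← ENNReal.ofReal_div_of_pos (by norm_num)]; congr 1; ring
    rw [ENNReal.ofReal_le_ofReal_iff (by positivity)] at h3
    have hr0 : 0 < r := by linarith [hr.1]
    have h5 : (1/2 : ℝ) ^ (2 * κ) ≤ r ^ (2 * κ) :=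
      Real.rpow_le_rpow (by norm_num) hr.1.le (by positivity)
    have h6 : (1/2 : ℝ) ^ (2 * κ) * (2 ^ κ) ^ 2 = 1 := by
      rw [one_div, Real.inv_rpow (by norm_num), ← Real.rpow_natCast, ← Real.rpow_mul (by norm_num)]
      have : κ * ((2:ℕ):ℝ) = 2 * κ := by push_cast; ring
      rw [this]; field_simp
    refine abs_le_of_sq_le_sq' ?_ (by positivity) |>.2
    rw [Real.rpow_add_one (by norm_num)]
    have h7 : (1/2 : ℝ) ^ (2 * κ) * ‖w r‖ ^ 2 ≤ 2 * K ^ 2 :=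
      le_trans (by gcongr) h3
    calc ‖w r‖ ^ 2 = (2 ^ κ) ^ 2 * ((1/2 : ℝ) ^ (2 * κ) * ‖w r‖ ^ 2) := by
          rw [← mul_assoc, mul_comm ((2 ^ κ) ^ 2 : ℝ), h6, one_mul]
      _ ≤ (2 ^ κ) ^ 2 * (2 * K ^ 2) := by gcongr
      _ ≤ _ := by nlinarith [sq_nonneg ((2:ℝ) ^ κ * K)]
  have key : ∀ x y, 0 < x → x ≤ y → y < 1 → ‖w y - w x‖ ≤ x ^ (-S) / √(2 * S) * K := by
    intro x y hx hxy hy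
    refine cs_diff hK (by positivity) hx.le hxy hy.le
      (hw.mono fun t ht => ⟨hx.trans_le ht.1, ht.2.trans_lt hy⟩) h2 ?_
    refine (lint_pow hS hx hxy).trans (le_of_eq ?_)
    congr 1
    rw [div_pow, Real.sq_sqrt (by positivity), ← Real.rpow_natCast, ← Real.rpow_mul hx.le]
    congr 2; push_cast; ring
  intro s hs
  have hs0 : 0 < s := hs.1
  have h7 : ‖w s - w r‖ ≤ 2 ^ S / √(2 * S) * K * s ^ (-S) := by
    rcases le_total s r with hle | hle
    · rw [norm_sub_rev]
      refine (key s r hs0 hle hr.2).trans ?_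
      have : (1:ℝ) ≤ 2 ^ S := Real.one_le_rpow (by norm_num) hS.le
      calc s ^ (-S) / √(2 * S) * K = 1 * (s ^ (-S) / √(2 * S) * K) := by ring
        _ ≤ 2 ^ S * (s ^ (-S) / √(2 * S) * K) := by gcongr
        _ = _ := by ring
    · have hr0 : 0 < r := by linarith [hr.1]
      refine (key r s hr0 hle hs.2).trans ?_
      have h8 : r ^ (-S) ≤ 2 ^ S * s ^ (-S) := by
        have : r ^ (-S) ≤ (s / 2) ^ (-S) :=
          Real.rpow_le_rpow_of_nonpos (by positivity) (by linarith [hr.1, hs.2]) (by linarith)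
        refine this.trans (le_of_eq ?_)
        rw [Real.div_rpow hs0.le (by norm_num), Real.rpow_neg (by norm_num : (0:ℝ) ≤ 2)]
        field_simp
      calc r ^ (-S) / √(2 * S) * K ≤ 2 ^ S * s ^ (-S) / √(2 * S) * K := by gcongr
        _ = _ := by ring
  have h9 : (1:ℝ) ≤ s ^ (-S) := Real.one_le_rpow_of_pos_of_le_one_of_nonpos hs0 hs.2.le (by linarith)
  calc ‖w s‖ = ‖w r + (w s - w r)‖ := by congr 1; abel
    _ ≤ ‖w r‖ + ‖w s - w r‖ := norm_add_le _ _
    _ ≤ 2 ^ (κ + 1) * K * s ^ (-S) + 2 ^ S / √(2 * S) * K * s ^ (-S) := by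
        gcongr
        exact hwr.trans (le_mul_of_one_le_right (by positivity) h9)
    _ = _ := by ring

theorem iter_smooth {E : Type*} [NormedAddCommGroup E] [NormedSpace ℝ E] {f : ℝ → E}
    (hf : ContDiffOn ℝ (⊤ : ℕ∞) f (Set.Ioo 0 1)) (n : ℕ) :
    ContDiffOn ℝ (⊤ : ℕ∞) (iteratedDeriv n f) (Set.Ioo 0 1) := by
  induction n with
  | zero => simpa using hf
  | succ n ih =>
    rw [iteratedDeriv_succ]
    exact ((contDiffOn_infty_iff_deriv_of_isOpen isOpen_Ioo).1 ih).2

theorem tau_smooth {q h τ : ℝ → ℝ} (hq : ContDiffOn ℝ (⊤ : ℕ∞) q (Set.Ioo 0 1))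
    (hh : ContDiffOn ℝ (⊤ : ℕ∞) h (Set.Ioo 0 1)) (hτ : ContDiff ℝ 2 τ)
    (he : ∀ s ∈ Set.Ioo (0:ℝ) 1, deriv (deriv τ) s = q s * τ s - h s) :
    ContDiffOn ℝ (⊤ : ℕ∞) τ (Set.Ioo 0 1) := by
  have hd1 : Differentiable ℝ τ := hτ.differentiable (by norm_num)
  have hτ' : ContDiff ℝ 1 (deriv τ) := by
    have : ContDiff ℝ (1 + 1) τ := by norm_num; exact hτ
    exact (contDiff_succ_iff_deriv.1 this).2.2
  have hd2 : Differentiable ℝ (deriv τ) := hτ'.differentiable (by norm_num)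
  have key : ∀ n : ℕ, ContDiffOn ℝ n τ (Set.Ioo 0 1) := by
    intro n
    induction n with
    | zero => exact (hτ.of_le (by norm_num)).contDiffOn
    | succ n ih =>
      have h2 : ContDiffOn ℝ n (deriv (deriv τ)) (Set.Ioo 0 1) := by
        refine ContDiffOn.congr ?_ he
        exact ((hq.of_le (by exact_mod_cast le_top)).mul ih).sub
          (hh.of_le (by exact_mod_cast le_top))
      have h1 : ContDiffOn ℝ (n + 1) (deriv τ) (Set.Ioo 0 1) :=
        (contDiffOn_succ_iff_deriv_of_isOpen isOpen_Ioo).2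
          ⟨hd2.differentiableOn, by simp, h2⟩
      push_cast
      exact (contDiffOn_succ_iff_deriv_of_isOpen isOpen_Ioo).2
          ⟨hd1.differentiableOn, by simp, h1.of_le (by norm_cast; omega)⟩
  exact contDiffOn_infty.2 key

theorem cs_one {f : ℝ → ℝ} {K : ℝ} (hK : 0 ≤ K) (hf : ContinuousOn f (Set.Ioo 0 1))
    (h : L2B (1/2) f K) :
    ∫⁻ s in Set.Ioo (0:ℝ) 1, ENNReal.ofReal (s ^ (1/2 : ℝ) * |f s|) ≤ ENNReal.ofReal K := by
  have hcpow : ContinuousOn (fun t : ℝ => t ^ (1/2 : ℝ)) (Set.Ioo 0 1) :=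
    continuousOn_id.rpow_const fun t ht => Or.inl ht.1.ne'
  have h3 := ENNReal.lintegral_mul_le_Lp_mul_Lq (volume.restrict (Set.Ioo (0:ℝ) 1))
    Real.HolderConjugate.two_two (f := fun _ : ℝ => 1)
    (g := fun t : ℝ => ENNReal.ofReal (t ^ (1/2 : ℝ) * |f t|)) aemeasurable_const
    (ENNReal.measurable_ofReal.comp_aemeasurable
      ((hcpow.mul hf.abs).aemeasurable measurableSet_Ioo))
  have h5 : ∫⁻ t in Set.Ioo (0:ℝ) 1, ENNReal.ofReal (t ^ (1/2 : ℝ) * |f t|) ^ (2:ℝ) ≤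
      ENNReal.ofReal (K ^ 2) := by
    refine le_trans (setLIntegral_mono' measurableSet_Ioo fun t ht => ?_) h
    have ht0 : 0 < t := ht.1
    rw [ENNReal.ofReal_rpow_of_nonneg (by positivity) (by norm_num),
      Real.mul_rpow (by positivity) (by positivity), ← Real.rpow_mul ht0.le,
      Real.rpow_two, mul_comm (1/2 : ℝ) 2, Real.norm_eq_abs]
  have hrt : ∀ a : ℝ, 0 ≤ a → ENNReal.ofReal (a ^ 2) ^ ((1:ℝ) / 2) = ENNReal.ofReal a := by
    intro a ha
    rw [ENNReal.ofReal_rpow_of_nonneg (by positivity) (by norm_num), ← Real.sqrt_eq_rpow,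
      Real.sqrt_sq ha]
  have h6 : ∫⁻ s in Set.Ioo (0:ℝ) 1, ENNReal.ofReal (s ^ (1/2 : ℝ) * |f s|) ≤
      1 * (∫⁻ t in Set.Ioo (0:ℝ) 1, ENNReal.ofReal (t ^ (1/2 : ℝ) * |f t|) ^ (2:ℝ)) ^ ((1:ℝ)/2) := by
    simpa using h3
  rw [one_mul] at h6
  refine h6.trans ?_
  rw [← hrt K hK]
  gcongr

theorem sqrt_bound {τ : ℝ → ℝ} {D : ℝ} (hD : 0 ≤ D) (hτ : ContDiff ℝ 1 τ) (h0 : τ 0 = 0)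
    (hL : L2B 0 (deriv τ) D) : ∀ s ∈ Set.Icc (0:ℝ) 1, |τ s| ≤ s ^ (1/2 : ℝ) * D := by
  intro s hs
  have := cs_diff (γ := 0) (J := s ^ (1/2 : ℝ)) hD (Real.rpow_nonneg hs.1 _) le_rfl hs.1 hs.2
    hτ.contDiffOn hL ?_
  · simpa [h0] using this
  · simp only [mul_zero, neg_zero, Real.rpow_zero, ENNReal.ofReal_one, lintegral_const,
      Measure.restrict_apply_univ, Real.volume_Ioo, one_mul, sub_zero]
    rw [← Real.sqrt_eq_rpow, Real.sq_sqrt hs.1]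

theorem energy {q h τ : ℝ → ℝ} {H N : ℝ} (hτ : ContDiff ℝ 2 τ) (hq : ∀ s, 0 ≤ q s)
    (hh : ContinuousOn h (Set.Ioo 0 1)) (hH : 0 ≤ H) (hL : L2B (1/2) h H)
    (he : ∀ s ∈ Set.Ioo (0:ℝ) 1, deriv (deriv τ) s = q s * τ s - h s) (h0 : τ 0 = 0)
    (ha : |deriv τ 1| ≤ N) : L2B 0 (deriv τ) (N + H) := by
  have hτ' : ContDiff ℝ 1 (deriv τ) := by
    have : ContDiff ℝ (1 + 1) τ := by norm_num; exact hτ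
    exact (contDiff_succ_iff_deriv.1 this).2.2
  have hτ'' : Continuous (deriv (deriv τ)) := by
    have : ContDiff ℝ (0 + 1) (deriv τ) := by simpa using hτ'
    exact (contDiff_succ_iff_deriv.1 this).2.2.continuous
  have hd1 : Differentiable ℝ τ := hτ.differentiable (by norm_num)
  have hd2 : Differentiable ℝ (deriv τ) := hτ'.differentiable (by norm_num)
  have hN : 0 ≤ N := (abs_nonneg _).trans ha
  set I : ℝ := ∫ s in Set.Ioo (0:ℝ) 1, deriv τ s ^ 2 with hI
  have hI0 : 0 ≤ I := integral_nonneg fun s => sq_nonneg _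
  have hint : ∀ f : ℝ → ℝ, Continuous f → IntegrableOn f (Set.Ioo 0 1) := fun f hf =>
    (hf.integrableOn_Icc (a := 0) (b := 1)).mono_set Set.Ioo_subset_Icc_self
  have hsq : (√I) ^ 2 = I := Real.sq_sqrt hI0
  have hLD : L2B 0 (deriv τ) (√I) := by
    unfold L2B
    rw [hsq, hI, ofReal_integral_eq_lintegral_ofReal (f := fun s => deriv τ s ^ 2)
      (hint _ (hτ'.continuous.pow 2))
      (Filter.Eventually.of_forall fun s => sq_nonneg _)]
    simp
  refine hLD.mono_K (Real.sqrt_nonneg _) ?_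
  have hb := sqrt_bound (Real.sqrt_nonneg I) (hτ.of_le (by norm_num)) h0 hLD
  set D := √I
  have hD0 : 0 ≤ D := Real.sqrt_nonneg _
  have hibp := intervalIntegral.integral_mul_deriv_eq_deriv_mul (a := 0) (b := 1)
    (u := τ) (v := deriv τ) (u' := deriv τ) (v' := deriv (deriv τ))
    (fun x _ => (hd1 x).hasDerivAt) (fun x _ => (hd2 x).hasDerivAt)
    (hτ'.continuous.intervalIntegrable _ _) (hτ''.intervalIntegrable _ _)
  rw [intervalIntegral.integral_of_le zero_le_one, intervalIntegral.integral_of_le zero_le_one,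
    integral_Ioc_eq_integral_Ioo, integral_Ioc_eq_integral_Ioo, h0] at hibp
  have hI' : I = τ 1 * deriv τ 1 + ∫ s in Set.Ioo (0:ℝ) 1, -(τ s * deriv (deriv τ) s) := by
    rw [integral_neg, hibp, hI]
    simp only [sq]; ring
  have hle : ∫ s in Set.Ioo (0:ℝ) 1, -(τ s * deriv (deriv τ) s) ≤ D * H := by
    rw [integral_eq_lintegral_pos_part_sub_lintegral_neg_part
      (f := fun s => -(τ s * deriv (deriv τ) s))
      (hint _ (hd1.continuous.mul hτ'').neg)]
    have h1 : ∫⁻ s in Set.Ioo (0:ℝ) 1, ENNReal.ofReal (-(τ s * deriv (deriv τ) s)) ≤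
        ENNReal.ofReal (D * H) := by
      rw [ENNReal.ofReal_mul hD0]
      calc _ ≤ ∫⁻ s in Set.Ioo (0:ℝ) 1, ENNReal.ofReal D * 
            ENNReal.ofReal (s ^ (1/2 : ℝ) * |h s|) := by
            refine setLIntegral_mono' measurableSet_Ioo fun s hs => ?_
            rw [← ENNReal.ofReal_mul hD0]
            apply ENNReal.ofReal_le_ofReal
            rw [he s hs]
            have h2 := hb s ⟨hs.1.le, hs.2.le⟩
            have h3 : τ s * h s ≤ |τ s| * |h s| := by rw [← abs_mul]; exact le_abs_self _
            have h4 : |τ s| * |h s| ≤ s ^ (1/2 : ℝ) * D * |h s| := by gcongr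
            nlinarith [mul_nonneg (hq s) (sq_nonneg (τ s))]
        _ = ENNReal.ofReal D * ∫⁻ s in Set.Ioo (0:ℝ) 1, 
            ENNReal.ofReal (s ^ (1/2 : ℝ) * |h s|) := by
            rw [lintegral_const_mul' _ _ ENNReal.ofReal_ne_top]
        _ ≤ _ := by gcongr; exact cs_one hH hh hL
    have h2 := ENNReal.toReal_mono ENNReal.ofReal_ne_top h1
    rw [ENNReal.toReal_ofReal (by positivity)] at h2
    have h3 : 0 ≤ (∫⁻ s in Set.Ioo (0:ℝ) 1, ENNReal.ofReal (- -(τ s * deriv (deriv τ) s))).toReal :=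
      ENNReal.toReal_nonneg
    linarith
  have h1 : |τ 1| ≤ D := by simpa using hb 1 ⟨zero_le_one, le_rfl⟩
  have h2 : τ 1 * deriv τ 1 ≤ D * N := by
    calc _ ≤ |τ 1 * deriv τ 1| := le_abs_self _
      _ = |τ 1| * |deriv τ 1| := abs_mul _ _
      _ ≤ _ := by gcongr
  have h3 : D * D ≤ D * (N + H) := by nlinarith
  rcases hD0.eq_or_lt with h | h
  · rw [← h]; positivity
  · exact le_of_mul_le_mul_left h3 h

theorem wL2_sq {E : Type*} [NormedAddCommGroup E] (α : ℝ) (v : ℝ → E) :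
    wL2 α v ^ 2 = ∫⁻ s in Set.Ioo (0:ℝ) 1, ENNReal.ofReal (s ^ (2 * α) * ‖v s‖ ^ 2) := by
  unfold wL2
  rw [← ENNReal.rpow_natCast, ← ENNReal.rpow_mul]; norm_num

theorem Y_term {E : Type*} [NormedAddCommGroup E] [NormedSpace ℝ E] (m n : ℕ) (hn : n ≤ m)
    (u : ℝ → E) : wL2 (max 0 ((n:ℝ) - ((m:ℝ) - 1) / 2)) (iteratedDeriv n u) ^ 2 ≤ YnormSq m u := by
  unfold YnormSq
  rcases Nat.even_or_odd' m with ⟨k, rfl | rfl⟩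
  · rw [if_pos (by omega)]
    have hk : 2 * k / 2 = k := by omega
    rw [hk]
    by_cases h : n < k
    · have : max 0 ((n:ℝ) - (((2 * k : ℕ):ℝ) - 1) / 2) = 0 := by
        apply max_eq_left
        have : (n:ℝ) + 1 ≤ k := by exact_mod_cast h
        push_cast; linarith
      rw [this]
      refine le_trans ?_ le_self_add
      exact Finset.single_le_sum (f := fun i => wL2 0 (iteratedDeriv i u) ^ 2)
        (fun _ _ => zero_le) (Finset.mem_range.2 h)
    · push Not at h
      obtain ⟨j, rfl⟩ := Nat.exists_eq_add_of_le h
      have : max 0 (((k + j : ℕ):ℝ) - (((2 * k : ℕ):ℝ) - 1) / 2) = j + 1 / 2 := by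
        push_cast; rw [max_eq_right] <;> [ring; (ring_nf; positivity)]
      rw [this]
      refine le_trans ?_ le_add_self
      exact Finset.single_le_sum 
        (f := fun j : ℕ => wL2 ((j:ℝ) + 1 / 2) (iteratedDeriv (k + j) u) ^ 2)
        (fun _ _ => zero_le) (Finset.mem_range.2 (by omega))
  · rw [if_neg (by omega)]
    have hk : (2 * k + 1) / 2 = k := by omega
    rw [hk]
    by_cases h : n < k + 1
    · have : max 0 ((n:ℝ) - (((2 * k + 1 : ℕ):ℝ) - 1) / 2) = 0 := by
        apply max_eq_left
        have : (n:ℝ) ≤ k := by exact_mod_cast Nat.lt_succ_iff.1 h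
        push_cast; linarith
      rw [this]
      refine le_trans ?_ le_self_add
      exact Finset.single_le_sum (f := fun i => wL2 0 (iteratedDeriv i u) ^ 2)
        (fun _ _ => zero_le) (Finset.mem_range.2 h)
    · push Not at h
      obtain ⟨j, rfl⟩ := Nat.exists_eq_add_of_le h
      have : max 0 (((k + 1 + j : ℕ):ℝ) - (((2 * k + 1 : ℕ):ℝ) - 1) / 2) = j + 1 := by
        push_cast; rw [max_eq_right] <;> [ring; (ring_nf; positivity)]
      rw [this, show k + 1 + j = k + j + 1 by ring]
      refine le_trans ?_ le_add_self
      exact Finset.single_le_sum 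
        (f := fun j : ℕ => wL2 ((j:ℝ) + 1) (iteratedDeriv (k + j + 1) u) ^ 2)
        (fun _ _ => zero_le) (Finset.mem_range.2 (by omega))

theorem X_le {E : Type*} [NormedAddCommGroup E] [NormedSpace ℝ E] (m : ℕ) (B : ℝ≥0∞)
    (u : ℝ → E) (hB : ∀ l ≤ m, wL2 (max 0 ((l:ℝ) - (m:ℝ) / 2)) (iteratedDeriv l u) ^ 2 ≤ B) :
    XnormSq m u ≤ ((2 * m + 2 : ℕ) : ℝ≥0∞) * B := by
  have h0 : ∀ i ∈ Finset.range (m / 2 + 1), wL2 0 (iteratedDeriv i u) ^ 2 ≤ B := by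
    intro i hi
    rw [Finset.mem_range] at hi
    have := hB i (by omega)
    rwa [max_eq_left] at this
    have : ((2 * i : ℕ) : ℝ) ≤ m := by norm_cast; omega
    push_cast at this; linarith
  have hs0 := Finset.sum_le_card_nsmul _ _ _ h0
  have fin : ∀ c1 c2 : ℕ, c1 + c2 ≤ 2 * m + 2 → c1 • B + c2 • B ≤ ((2 * m + 2 : ℕ) : ℝ≥0∞) * B := by
    intro c1 c2 h
    rw [← add_smul, nsmul_eq_mul]
    gcongr
  unfold XnormSq
  split_ifs with h
  · have h1 : ∀ j ∈ Finset.range (m / 2),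
        wL2 ((j : ℝ) + 1) (iteratedDeriv (m / 2 + j + 1) u) ^ 2 ≤ B := by
      intro j hj
      rw [Finset.mem_range] at hj
      have := hB (m / 2 + j + 1) (by omega)
      have e : (m:ℝ) = 2 * ((m / 2 : ℕ) : ℝ) := by norm_cast; omega
      rwa [show max 0 (((m / 2 + j + 1 : ℕ):ℝ) - (m:ℝ) / 2) = j + 1 by
        rw [e]; push_cast; rw [max_eq_right] <;> [ring; (ring_nf; positivity)]] at this
    refine (add_le_add hs0 (Finset.sum_le_card_nsmul _ _ _ h1)).trans (fin _ _ ?_)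
    simp only [Finset.card_range]; omega
  · have h1 : ∀ j ∈ Finset.range (m / 2 + 1),
        wL2 ((j : ℝ) + 1 / 2) (iteratedDeriv (m / 2 + j + 1) u) ^ 2 ≤ B := by
      intro j hj
      rw [Finset.mem_range] at hj
      have := hB (m / 2 + j + 1) (by omega)
      have e : (m:ℝ) = 2 * ((m / 2 : ℕ) : ℝ) + 1 := by norm_cast; omega
      rwa [show max 0 (((m / 2 + j + 1 : ℕ):ℝ) - (m:ℝ) / 2) = j + 1 / 2 by
        rw [e]; push_cast; rw [max_eq_right] <;> [ring; (ring_nf; positivity)]] at this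
    refine (add_le_add hs0 (Finset.sum_le_card_nsmul _ _ _ h1)).trans (fin _ _ ?_)
    simp only [Finset.card_range]; omega

theorem Y_L2B {E : Type*} [NormedAddCommGroup E] [NormedSpace ℝ E] {m : ℕ} {u : ℝ → E} {M : ℝ}
    (hY : Ynorm m u ≤ ENNReal.ofReal M) (hM : 0 ≤ M) (n : ℕ) (hn : n ≤ m) :
    L2B (max 0 ((n:ℝ) - ((m:ℝ) - 1) / 2)) (iteratedDeriv n u) M := by
  unfold L2B
  rw [← wL2_sq]
  refine (Y_term m n hn u).trans ?_
  have : YnormSq m u = Ynorm m u ^ 2 := by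
    unfold Ynorm
    rw [← ENNReal.rpow_natCast, ← ENNReal.rpow_mul]; norm_num
  rw [this, ENNReal.ofReal_pow hM]
  gcongr

/-- L² weight exponents for derivatives of `u'`. -/
def Wt (p a : ℕ) : ℝ := if 2 * a + 5 ≤ p + 1 then -1/4 else (a:ℝ) - ((p:ℝ) - 3) / 2
/-- Sup weight exponents for derivatives of `u'`. -/
def St (p b : ℕ) : ℝ := if 2 * b + 5 ≤ p + 1 then 1/8 else (b:ℝ) + 2 - (p:ℝ) / 2
/-- Sup weight exponents for derivatives of `τ` (in the step of order `n`). -/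
def Tt (m n c : ℕ) : ℝ :=
  if n = 0 then -1/2 else if c ≤ 1 then (c:ℝ) - 1 else
    if 2 * c ≤ m + 1 then 1/8 else (c:ℝ) - (m:ℝ) / 2 - 1/2

set_option maxHeartbeats 8000000 in
theorem weights (m n a b c : ℕ) (hn : n < m) (hab : b ≤ a) (habc : a + b + c = n) :
    Wt (max m 3) a + (St (max m 3) b + Tt m n c) ≤ max 0 ((n:ℝ) + 1 - (m:ℝ) / 2) := by
  subst habc
  have key : ∀ (p : ℕ), (m ≤ 3 ∧ p = 3 ∨ 3 ≤ m ∧ p = m) →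
      Wt p a + (St p b + Tt m (a + b + c) c) ≤ max 0 (((a + b + c : ℕ):ℝ) + 1 - (m:ℝ) / 2) := by
    intro p hp
    unfold Wt St Tt
    push_cast
    rw [le_max_iff]
    by_cases ht : 2 * (a + b + c + 1) ≤ m
    · left
      split_ifs <;> push_cast at * <;> rify at * <;> grind
    · right
      have hc2 : c ≤ 1 ∨ 2 ≤ c := by omega
      have hn2 : a + b + c + 1 ≤ m := by omega
      have ht2 : m + 1 ≤ 2 * (a + b + c + 1) := by omega
      have ha2 : 2 * a + 5 ≤ p + 1 ∨ p + 2 ≤ 2 * a + 5 := by omega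
      have hb2 : 2 * b + 5 ≤ p + 1 ∨ p + 2 ≤ 2 * b + 5 := by omega
      have hcm : 2 * c ≤ m + 1 ∨ m + 2 ≤ 2 * c := by omega
      split_ifs <;> rify at * <;> grind
  apply key
  omega

structure DataH (M : ℝ) (m : ℕ) (u : ℝ → EuclideanSpace ℝ (Fin 3)) (h τ : ℝ → ℝ) (N : ℝ) :
    Prop where
  hM : 0 ≤ M
  hu : ContDiffOn ℝ (⊤ : ℕ∞) u (Set.Ioo 0 1)
  huY : ∀ j ≤ max m 3, L2B (max 0 ((j:ℝ) - (((max m 3 : ℕ) : ℝ) - 1) / 2)) (iteratedDeriv j u) M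
  hh : ContDiffOn ℝ (⊤ : ℕ∞) h (Set.Ioo 0 1)
  hhY : ∀ n < m, L2B (max 0 ((n:ℝ) + 1 - (m:ℝ) / 2)) (iteratedDeriv n h) N
  hτ : ContDiff ℝ 2 τ
  he : ∀ s ∈ Set.Ioo (0:ℝ) 1, deriv (deriv τ) s = ‖deriv u s‖ ^ 2 * τ s - h s
  h0 : τ 0 = 0
  ha : |deriv τ 1| ≤ N
  hN : 0 ≤ N

namespace DataH

variable {M : ℝ} {m : ℕ} {u : ℝ → EuclideanSpace ℝ (Fin 3)} {h τ : ℝ → ℝ} {N : ℝ}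

theorem hv (d : DataH M m u h τ N) : ContDiffOn ℝ (⊤ : ℕ∞) (deriv u) (Set.Ioo 0 1) :=
  ((contDiffOn_infty_iff_deriv_of_isOpen isOpen_Ioo).1 d.hu).2

theorem hq (d : DataH M m u h τ N) :
    ContDiffOn ℝ (⊤ : ℕ∞) (fun s => ‖deriv u s‖ ^ 2) (Set.Ioo 0 1) := d.hv.norm_sq ℝ

theorem hτs (d : DataH M m u h τ N) : ContDiffOn ℝ (⊤ : ℕ∞) τ (Set.Ioo 0 1) :=
  tau_smooth d.hq d.hh d.hτ d.he

end DataH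

theorem v_sup (M : ℝ) (m j : ℕ) (hj : j + 2 ≤ max m 3) : ∃ K : ℝ, 0 ≤ K ∧ ∀ u h τ N,
    DataH M m u h τ N → ∀ s ∈ Set.Ioo (0:ℝ) 1,
      ‖iteratedDeriv j (deriv u) s‖ ≤ K * s ^ (-(St (max m 3) j)) := by
  by_cases hM : 0 ≤ M
  swap
  · exact ⟨0, le_rfl, fun u h τ N d => absurd d.hM hM⟩
  have hS : 0 < St (max m 3) j ∧ (j:ℝ) + 2 - (((max m 3 : ℕ) : ℝ) - 1) / 2 ≤ St (max m 3) j + 1/2 := by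
    generalize max m 3 = p
    unfold St
    split_ifs with h
    · have : 2 * (j:ℝ) + 5 ≤ p + 1 := by exact_mod_cast h
      constructor <;> linarith
    · push Not at h
      have : (p:ℝ) + 2 ≤ 2 * j + 5 := by exact_mod_cast h
      constructor <;> linarith
  refine ⟨(2 ^ (max 0 (((j+1 : ℕ):ℝ) - (((max m 3 : ℕ) : ℝ) - 1) / 2) + 1) +
    2 ^ (St (max m 3) j) / √(2 * (St (max m 3) j))) * M, by positivity, ?_⟩
  intro u h τ N d
  have h1 := d.huY (j + 1) (by omega)
  have h2 := (d.huY (j + 2) (by omega)).mono (β := St (max m 3) j + 1/2)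
    (max_le (by linarith [hS.1]) (by push_cast at hS ⊢; linarith [hS.2]))
  rw [iteratedDeriv_succ'] at h1
  rw [iteratedDeriv_succ', iteratedDeriv_succ] at h2
  exact sup_bound hS.1 (le_max_left _ _) hM ((iter_smooth d.hv j).of_le (by exact_mod_cast le_top))
    h1 h2

theorem v_L2 (M : ℝ) (m j : ℕ) (hj : j + 1 ≤ max m 3) : ∃ K : ℝ, 0 ≤ K ∧ ∀ u h τ N,
    DataH M m u h τ N → L2B (Wt (max m 3) j) (iteratedDeriv j (deriv u)) K := by
  by_cases hM : 0 ≤ M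
  swap
  · exact ⟨0, le_rfl, fun u h τ N d => absurd d.hM hM⟩
  by_cases hc : 2 * j + 5 ≤ max m 3 + 1
  · obtain ⟨K, hK, hKs⟩ := v_sup M m j (by omega)
    refine ⟨K * 2, by positivity, fun u h τ N d => ?_⟩
    have hW : Wt (max m 3) j = -1/4 := if_pos hc
    have hSt : St (max m 3) j = 1/8 := if_pos hc
    have h1 : L2B (-3/8) (fun _ : ℝ => (1:ℝ)) 2 := by
      unfold L2B
      have hmeas : IntegrableOn (fun t : ℝ => t ^ (-3/4 : ℝ)) (Set.Ioo 0 1) :=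
        (intervalIntegral.integrableOn_Ioo_rpow_iff zero_lt_one).2 (by norm_num)
      have e : ∫⁻ s in Set.Ioo (0:ℝ) 1, ENNReal.ofReal (s ^ (2 * (-3/8 : ℝ)) * ‖(1:ℝ)‖ ^ 2) =
          ENNReal.ofReal (∫ s in Set.Ioo (0:ℝ) 1, s ^ (-3/4 : ℝ)) := by
        rw [ofReal_integral_eq_lintegral_ofReal hmeas]
        · norm_num
        · refine (ae_restrict_iff' measurableSet_Ioo).2 (Filter.Eventually.of_forall fun t ht => ?_)
          exact Real.rpow_nonneg ht.1.le _
      rw [e]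
      apply ENNReal.ofReal_le_ofReal
      rw [← integral_Ioc_eq_integral_Ioo, ← intervalIntegral.integral_of_le zero_le_one,
        integral_rpow (Or.inl (by norm_num))]
      norm_num
    rw [hW]
    refine L2B_of_le (δ := 1/8) hK (fun s hs => ?_) h1 (by norm_num)
    have := hKs u h τ N d s hs
    rw [hSt] at this
    simpa using this
  · refine ⟨M, hM, fun u h τ N d => ?_⟩
    have h1 := d.huY (j + 1) hj
    rw [iteratedDeriv_succ'] at h1
    refine h1.mono ?_
    rw [Wt, if_neg hc]
    have : ((max m 3 : ℕ) : ℝ) + 2 ≤ 2 * j + 5 := by exact_mod_cast (not_le.1 hc)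
    apply max_le
    · linarith
    · push_cast at this ⊢; linarith

/-- The claim of order `l`. -/
def Claim (M : ℝ) (m l : ℕ) : Prop := ∃ C : ℝ, 0 ≤ C ∧ ∀ u h τ N, DataH M m u h τ N →
  L2B (max 0 ((l:ℝ) - (m:ℝ) / 2)) (iteratedDeriv l (deriv τ)) (C * N)

theorem claim_zero (M : ℝ) (m : ℕ) (hm : 1 ≤ m) : Claim M m 0 := by
  refine ⟨2, by norm_num, fun u h τ N d => ?_⟩
  have h1 := (d.hhY 0 (by omega)).mono (β := 1/2) (max_le (by norm_num) (by
    have : (1:ℝ) ≤ m := by exact_mod_cast hm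
    push_cast; linarith))
  rw [iteratedDeriv_zero] at h1
  have := energy d.hτ (fun s => sq_nonneg ‖deriv u s‖) d.hh.continuousOn d.hN h1 d.he d.h0 d.ha
  rw [iteratedDeriv_zero, two_mul]
  exact this.mono (le_max_left _ _)

theorem tau_sup (M : ℝ) (m n c : ℕ) (hn : n < m) (hc : c ≤ n) (ih : ∀ l ≤ n, Claim M m l) :
    ∃ C : ℝ, 0 ≤ C ∧ ∀ u h τ N, DataH M m u h τ N → ∀ s ∈ Set.Ioo (0:ℝ) 1,
      ‖iteratedDeriv c τ s‖ ≤ C * N * s ^ (-(Tt m n c)) := by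
  by_cases hn0 : n = 0
  · subst hn0
    obtain ⟨C, hC, hCL⟩ := ih 0 le_rfl
    refine ⟨C, hC, fun u h τ N d s hs => ?_⟩
    have hc0 : c = 0 := by omega
    subst hc0
    have h1 := hCL u h τ N d
    rw [max_eq_left (by push_cast; linarith [(Nat.cast_nonneg m : (0:ℝ) ≤ m)]),
      iteratedDeriv_zero] at h1
    have := sqrt_bound (mul_nonneg hC d.hN) (d.hτ.of_le (by norm_num)) d.h0 h1 s ⟨hs.1.le, hs.2.le⟩
    rw [iteratedDeriv_zero, Tt, if_pos rfl, Real.norm_eq_abs, mul_comm]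
    convert this using 3
    norm_num
  have hm2 : (2:ℝ) ≤ m := by norm_cast; omega
  by_cases hc1 : c ≤ 1
  · obtain ⟨C, hC, hCL⟩ := ih 1 (by omega)
    refine ⟨1 + C, by positivity, fun u h τ N d => ?_⟩
    have hN := d.hN
    have h1 := hCL u h τ N d
    rw [max_eq_left (by push_cast; linarith), iteratedDeriv_one] at h1
    have hd1 : Differentiable ℝ τ := d.hτ.differentiable (by norm_num)
    have hτ' : ContDiff ℝ 1 (deriv τ) := by
      have : ContDiff ℝ (1 + 1) τ := by norm_num; exact d.hτ
      exact (contDiff_succ_iff_deriv.1 this).2.2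
    have hb : ∀ s ∈ Set.Icc (0:ℝ) 1, ‖deriv τ s‖ ≤ (1 + C) * N := by
      intro s hs
      have h2 := cs_diff (γ := 0) (J := 1) (mul_nonneg hC d.hN) zero_le_one hs.1 hs.2 le_rfl
        hτ'.contDiffOn h1 (by
          simp only [mul_zero, neg_zero, Real.rpow_zero, ENNReal.ofReal_one, lintegral_const,
            Measure.restrict_apply_univ, Real.volume_Ioo, one_mul]
          exact ENNReal.ofReal_le_ofReal (by linarith [hs.1]))
      rw [one_mul] at h2
      have h3 := norm_sub_norm_le (deriv τ s) (deriv τ 1)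
      rw [norm_sub_rev] at h3
      have h4 := d.ha
      rw [← Real.norm_eq_abs] at h4
      linarith
    intro s hs
    have hs0 : 0 < s := hs.1
    rw [Tt, if_neg hn0, if_pos hc1]
    interval_cases c
    · have h5 := (convex_Icc (0:ℝ) 1).norm_image_sub_le_of_norm_deriv_le (f := τ)
        (fun x _ => hd1 x) hb (x := 0) (y := s) ⟨le_rfl, zero_le_one⟩ ⟨hs.1.le, hs.2.le⟩
      rw [d.h0, sub_zero, sub_zero, Real.norm_of_nonneg hs0.le] at h5
      simpa using h5
    · rw [iteratedDeriv_one]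
      simpa using hb s ⟨hs.1.le, hs.2.le⟩
  · obtain ⟨c, rfl⟩ : ∃ c', c = c' + 1 := ⟨c - 1, by omega⟩
    obtain ⟨C1, hC1, hL1⟩ := ih c (by omega)
    obtain ⟨C2, hC2, hL2⟩ := ih (c + 1) (by omega)
    have hS : 0 < Tt m n (c+1) ∧ ((c+1 : ℕ):ℝ) - (m:ℝ) / 2 ≤ Tt m n (c+1) + 1/2 := by
      rw [Tt, if_neg hn0, if_neg hc1]
      split_ifs with h
      · have : 2 * ((c+1 : ℕ):ℝ) ≤ m + 1 := by exact_mod_cast h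
        constructor <;> linarith
      · push Not at h
        have : (m:ℝ) + 2 ≤ 2 * ((c+1 : ℕ):ℝ) := by exact_mod_cast h
        constructor <;> linarith
    refine ⟨(2 ^ (max 0 ((c:ℝ) - (m:ℝ) / 2) + 1) +
      2 ^ (Tt m n (c+1)) / √(2 * (Tt m n (c+1)))) * (C1 + C2), by positivity, ?_⟩
    intro u h τ N d s hs
    have hN := d.hN
    have h1 := (hL1 u h τ N d).mono_K (K' := (C1 + C2) * N) (by positivity)
      (by nlinarith [mul_nonneg hC2 hN])
    have h2 := ((hL2 u h τ N d).mono_K (K' := (C1 + C2) * N) (by positivity)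
      (by nlinarith [mul_nonneg hC1 hN])).mono (β := Tt m n (c+1) + 1/2)
      (max_le (by linarith [hS.1]) hS.2)
    rw [iteratedDeriv_succ] at h2
    have hsm := iter_smooth d.hτs (c + 1)
    rw [iteratedDeriv_succ'] at hsm ⊢
    have := sup_bound hS.1 (le_max_left _ _) (by positivity) (hsm.of_le (by exact_mod_cast le_top))
      h1 h2 s hs
    rw [← mul_assoc] at this
    exact this

theorem term_L2 (M : ℝ) (m n a b c : ℕ) (hn : n < m) (habc : a + b + c = n)
    (ih : ∀ l ≤ n, Claim M m l) :
    ∃ C : ℝ, 0 ≤ C ∧ ∀ u h τ N, DataH M m u h τ N →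
      L2B (max 0 ((n:ℝ) + 1 - (m:ℝ) / 2)) (fun s => ‖iteratedDeriv a (deriv u) s‖ *
        ‖iteratedDeriv b (deriv u) s‖ * ‖iteratedDeriv c τ s‖) (C * N) := by
  wlog hab : b ≤ a generalizing a b
  · obtain ⟨C, hC, H⟩ := this b a (by omega) (by omega)
    refine ⟨C, hC, fun u h τ N d => ?_⟩
    have := H u h τ N d
    simpa only [mul_comm ‖iteratedDeriv b (deriv u) _‖] using this
  obtain ⟨K1, hK1, H1⟩ := v_L2 M m a (by omega)
  obtain ⟨K2, hK2, H2⟩ := v_sup M m b (by omega)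
  obtain ⟨K3, hK3, H3⟩ := tau_sup M m n c hn (by omega) ih
  refine ⟨K2 * K3 * K1, by positivity, fun u h τ N d => ?_⟩
  have hN := d.hN
  have := L2B_of_le (f := fun s => ‖iteratedDeriv a (deriv u) s‖ *
        ‖iteratedDeriv b (deriv u) s‖ * ‖iteratedDeriv c τ s‖)
    (δ := St (max m 3) b + Tt m n c) (c := K2 * (K3 * N)) (by positivity) ?_ (H1 u h τ N d)
    (weights m n a b c hn hab habc)
  · convert this using 1; ring
  · intro s hs
    have hs0 : 0 < s := hs.1
    have h2 := H2 u h τ N d s hs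
    have h3 := H3 u h τ N d s hs
    rw [Real.norm_of_nonneg (by positivity), neg_add, Real.rpow_add hs0]
    calc _ ≤ ‖iteratedDeriv a (deriv u) s‖ * (K2 * s ^ (-(St (max m 3) b))) *
          (K3 * N * s ^ (-(Tt m n c))) := by gcongr
      _ = _ := by ring

theorem leib (u : ℝ → EuclideanSpace ℝ (Fin 3)) (τ : ℝ → ℝ)
    (hv : ContDiffOn ℝ (⊤ : ℕ∞) (deriv u) (Set.Ioo 0 1))
    (hτ : ContDiffOn ℝ (⊤ : ℕ∞) τ (Set.Ioo 0 1)) (n : ℕ) (s : ℝ) (hs : s ∈ Set.Ioo (0:ℝ) 1) :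
    ‖iteratedDeriv n (fun s => ‖deriv u s‖ ^ 2 * τ s) s‖ ≤
      ∑ i ∈ Finset.range (n + 1), ∑ j ∈ Finset.range (i + 1), (n.choose i : ℝ) * (i.choose j) *
        (‖iteratedDeriv j (deriv u) s‖ * ‖iteratedDeriv (i - j) (deriv u) s‖ *
          ‖iteratedDeriv (n - i) τ s‖) := by
  have conv : ∀ {E : Type} [NormedAddCommGroup E] [NormedSpace ℝ E] (f : ℝ → E) (k : ℕ),
      ‖iteratedFDerivWithin ℝ k f (Set.Ioo 0 1) s‖ = ‖iteratedDeriv k f s‖ := by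
    intro E _ _ f k
    rw [norm_iteratedFDerivWithin_eq_norm_iteratedDerivWithin,
      iteratedDerivWithin_of_isOpen isOpen_Ioo hs]
  have h1 := norm_iteratedFDerivWithin_mul_le (hv.norm_sq ℝ) hτ (uniqueDiffOn_Ioo 0 1) hs
    (n := n) (by exact_mod_cast le_top)
  simp only [conv] at h1
  refine h1.trans (Finset.sum_le_sum fun i _ => ?_)
  have h2 := (innerSL ℝ (E := EuclideanSpace ℝ (Fin 3))).norm_iteratedFDerivWithin_le_of_bilinear_of_le_one
    hv hv (uniqueDiffOn_Ioo 0 1) hs (n := i) (by exact_mod_cast le_top) (norm_innerSL_le ℝ)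
  simp only [conv] at h2
  have e : (fun y : ℝ => innerSL ℝ (E := EuclideanSpace ℝ (Fin 3)) (deriv u y) (deriv u y)) =
      fun y => ‖deriv u y‖ ^ 2 := by
    funext y
    exact real_inner_self_eq_norm_sq (deriv u y)
  rw [e] at h2
  calc _ ≤ (n.choose i : ℝ) * (∑ j ∈ Finset.range (i + 1), (i.choose j : ℝ) *
        ‖iteratedDeriv j (deriv u) s‖ * ‖iteratedDeriv (i - j) (deriv u) s‖) *
          ‖iteratedDeriv (n - i) τ s‖ := by gcongr
    _ = _ := by
      rw [Finset.mul_sum, Finset.sum_mul]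
      refine Finset.sum_congr rfl fun j _ => by ring

theorem qtau_L2 (M : ℝ) (m n : ℕ) (hn : n < m) (ih : ∀ l ≤ n, Claim M m l) :
    ∃ C : ℝ, 0 ≤ C ∧ ∀ u h τ N, DataH M m u h τ N →
      L2B (max 0 ((n:ℝ) + 1 - (m:ℝ) / 2))
        (iteratedDeriv n (fun s => ‖deriv u s‖ ^ 2 * τ s)) (C * N) := by
  set A : Finset (Σ _ : ℕ, ℕ) := (Finset.range (n + 1)).sigma fun i => Finset.range (i + 1) with hA
  have hmem : ∀ x ∈ A, x.1 ≤ n ∧ x.2 ≤ x.1 := by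
    intro x hx
    simp only [hA, Finset.mem_sigma, Finset.mem_range] at hx
    omega
  have hex : ∀ x : Σ _ : ℕ, ℕ, ∃ C : ℝ, 0 ≤ C ∧ (x ∈ A → ∀ u h τ N, DataH M m u h τ N →
      L2B (max 0 ((n:ℝ) + 1 - (m:ℝ) / 2)) (fun s => ‖iteratedDeriv x.2 (deriv u) s‖ *
        ‖iteratedDeriv (x.1 - x.2) (deriv u) s‖ * ‖iteratedDeriv (n - x.1) τ s‖) (C * N)) := by
    intro x
    by_cases hx : x ∈ A
    · have := hmem x hx
      obtain ⟨C, hC, H⟩ := term_L2 M m n x.2 (x.1 - x.2) (n - x.1) hn (by omega) ih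
      exact ⟨C, hC, fun _ => H⟩
    · exact ⟨0, le_rfl, fun h => absurd h hx⟩
  choose C hC H using hex
  refine ⟨A.card * ∑ x ∈ A, (n.choose x.1 : ℝ) * (x.1.choose x.2) * C x,
    mul_nonneg (by positivity) (Finset.sum_nonneg fun x _ => mul_nonneg (by positivity) (hC x)),
    fun u h τ N d => ?_⟩
  have hN := d.hN
  have := L2B_sum A (α := max 0 ((n:ℝ) + 1 - (m:ℝ) / 2))
    (f := iteratedDeriv n (fun s => ‖deriv u s‖ ^ 2 * τ s))
    (g := fun x s => (n.choose x.1 : ℝ) * (x.1.choose x.2) * (‖iteratedDeriv x.2 (deriv u) s‖ *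
        ‖iteratedDeriv (x.1 - x.2) (deriv u) s‖ * ‖iteratedDeriv (n - x.1) τ s‖))
    (K := fun x => (n.choose x.1 : ℝ) * (x.1.choose x.2) * (C x * N))
    (fun x _ => mul_nonneg (by positivity) (mul_nonneg (hC x) hN)) ?_ ?_ ?_
  · convert this using 1
    rw [mul_assoc, Finset.sum_mul]
    congr 1
    exact Finset.sum_congr rfl fun x _ => by ring
  · intro x _
    exact continuousOn_const.mul ((((iter_smooth d.hv _).continuousOn.norm).mul
      ((iter_smooth d.hv _).continuousOn.norm)).mul ((iter_smooth d.hτs _).continuousOn.norm))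
  · intro s hs
    refine (leib u τ d.hv d.hτs n s hs).trans (le_of_eq ?_)
    rw [hA, Finset.sum_sigma]
    refine Finset.sum_congr rfl fun i _ => Finset.sum_congr rfl fun j _ => ?_
    exact (Real.norm_of_nonneg (by positivity)).symm
  · intro x hx
    refine L2B_of_le (δ := 0) (by positivity) (fun s hs => ?_) (H x hx u h τ N d) (by simp)
    rw [neg_zero, Real.rpow_zero, mul_one, norm_mul, Real.norm_of_nonneg (by positivity)]

theorem claim_succ (M : ℝ) (m n : ℕ) (hn : n < m) (ih : ∀ l ≤ n, Claim M m l) :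
    Claim M m (n + 1) := by
  obtain ⟨C, hC, H⟩ := qtau_L2 M m n hn ih
  refine ⟨2 * (C + 1), by positivity, fun u h τ N d => ?_⟩
  have hN := d.hN
  have h1 := H u h τ N d
  have h2 := d.hhY n hn
  have hqτ : ContDiffOn ℝ (⊤ : ℕ∞) (fun s => ‖deriv u s‖ ^ 2 * τ s) (Set.Ioo 0 1) :=
    d.hq.mul d.hτs
  have := L2B_sum (Finset.univ : Finset Bool) (α := max 0 ((n:ℝ) + 1 - (m:ℝ) / 2))
    (f := iteratedDeriv (n + 1) (deriv τ))
    (g := fun b => if b then iteratedDeriv n (fun s => ‖deriv u s‖ ^ 2 * τ s) else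
      iteratedDeriv n h) (K := fun b => if b then C * N else N) ?_ ?_ ?_ ?_
  · push_cast
    convert this using 1
    simp; ring
  · intro b _; cases b <;> simp <;> positivity
  · intro b _
    cases b
    · simpa using (iter_smooth d.hh n).continuousOn
    · simpa using (iter_smooth hqτ n).continuousOn
  · intro s hs
    have hnhds := isOpen_Ioo.mem_nhds hs
    have e : iteratedDeriv (n + 1) (deriv τ) s =
        iteratedDeriv n (fun s => ‖deriv u s‖ ^ 2 * τ s) s - iteratedDeriv n h s := by
      rw [iteratedDeriv_succ', ← iteratedDeriv_fun_sub]
      · apply Filter.EventuallyEq.iteratedDeriv_eq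
        filter_upwards [hnhds] with t ht using d.he t ht
      · exact (hqτ.contDiffAt hnhds).of_le (by exact_mod_cast le_top)
      · exact (d.hh.contDiffAt hnhds).of_le (by exact_mod_cast le_top)
    rw [e]
    have := norm_sub_le (iteratedDeriv n (fun s => ‖deriv u s‖ ^ 2 * τ s) s) (iteratedDeriv n h s)
    simpa using this
  · intro b _
    cases b
    · simpa using h2
    · simpa using h1

theorem claim_all (M : ℝ) (m : ℕ) (hm : 1 ≤ m) (l : ℕ) (hl : l ≤ m) : Claim M m l := by
  induction l using Nat.strong_induction_on with
  | _ l ih =>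
    cases l with
    | zero => exact claim_zero M m hm
    | succ n => exact claim_succ M m n (by omega) fun k hk => ih k (by omega) (by omega)

/-- elliptic estimate `‖τ'‖_{X^m} ≤ C(|a| + ‖h‖_{Y^{m-1}})` for the solution
of the two-point boundary value problem `-τ'' + |u'|² τ = h`, `τ(0) = 0`, `τ'(1) = a`. -/
theorem stmt11 (M : ℝ) (hM : 0 < M) (m : ℕ) (hm : 1 ≤ m) :
    ∃ C : ℝ, 0 < C ∧
      ∀ (u : ℝ → EuclideanSpace ℝ (Fin 3)) (h τ : ℝ → ℝ) (a : ℝ),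
        ContDiffOn ℝ (⊤ : ℕ∞) u (Set.Ioi 0) →
        Ynorm (max m 3) u ≤ ENNReal.ofReal M →
        ContDiffOn ℝ (⊤ : ℕ∞) h (Set.Ioi 0) →
        Ynorm (m - 1) h ≠ ⊤ →
        ContDiff ℝ 2 τ →
        (∀ s ∈ Set.Ioo (0:ℝ) 1, -(deriv (deriv τ) s) + ‖deriv u s‖ ^ 2 * τ s = h s) →
        τ 0 = 0 → deriv τ 1 = a →
        Xnorm m (deriv τ) ≤ ENNReal.ofReal C * (ENNReal.ofReal |a| + Ynorm (m - 1) h) := by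
  have hex : ∀ l : ℕ, ∃ C : ℝ, 0 ≤ C ∧ (l ≤ m → ∀ u h τ N, DataH M m u h τ N →
      L2B (max 0 ((l:ℝ) - (m:ℝ) / 2)) (iteratedDeriv l (deriv τ)) (C * N)) := by
    intro l
    by_cases hl : l ≤ m
    · obtain ⟨C, hC, H⟩ := claim_all M m hm l hl
      exact ⟨C, hC, fun _ => H⟩
    · exact ⟨0, le_rfl, fun h => absurd h hl⟩
  choose C hC H using hex
  set S : ℝ := ∑ l ∈ Finset.range (m + 1), C l with hSdef
  have hS0 : 0 ≤ S := Finset.sum_nonneg fun l _ => hC l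
  refine ⟨√(2 * m + 2) * S + 1, by positivity, ?_⟩
  intro u h τ a hu huY hh hhY hτ he h0 ha
  set Hn : ℝ := (Ynorm (m - 1) h).toReal with hHn
  have hHe : Ynorm (m - 1) h = ENNReal.ofReal Hn := (ENNReal.ofReal_toReal hhY).symm
  have hHn0 : 0 ≤ Hn := ENNReal.toReal_nonneg
  set N : ℝ := |a| + Hn with hNdef
  have hN : 0 ≤ N := by positivity
  have hsub : Set.Ioo (0:ℝ) 1 ⊆ Set.Ioi 0 := Set.Ioo_subset_Ioi_self
  have d : DataH M m u h τ N := by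
    refine ⟨hM.le, hu.mono hsub, fun j hj => Y_L2B huY hM.le j hj, hh.mono hsub, ?_, hτ, ?_, h0,
      ?_, hN⟩
    · intro n hn
      have h1 := (Y_L2B hHe.le hHn0 n (by omega)).mono_K hHn0
        (by rw [hNdef]; linarith [abs_nonneg a] : Hn ≤ N)
      convert h1 using 2
      rw [Nat.cast_sub hm]; push_cast; ring
    · intro s hs
      linarith [he s hs]
    · rw [ha, hNdef]; linarith
  have hX : XnormSq m (deriv τ) ≤ ((2 * m + 2 : ℕ) : ℝ≥0∞) * ENNReal.ofReal ((S * N) ^ 2) := by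
    refine X_le m _ _ fun l hl => ?_
    rw [wL2_sq]
    refine ((H l hl u h τ N d).mono_K (mul_nonneg (hC l) hN) ?_)
    gcongr
    exact Finset.single_le_sum (fun i _ => hC i) (Finset.mem_range.2 (by omega))
  rw [hHe, ← ENNReal.ofReal_add (abs_nonneg _) hHn0, ← ENNReal.ofReal_mul (by positivity)]
  unfold Xnorm
  have hX2 : XnormSq m (deriv τ) ≤ ENNReal.ofReal ((√(2 * m + 2) * S * N) ^ 2) := by
    refine hX.trans (le_of_eq ?_)
    rw [← ENNReal.ofReal_natCast, ← ENNReal.ofReal_mul (by positivity)]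
    congr 1
    have hsq := Real.sq_sqrt (show (0:ℝ) ≤ 2 * m + 2 by positivity)
    push_cast
    linear_combination -(S * N) ^ 2 * hsq
  calc XnormSq m (deriv τ) ^ ((1:ℝ) / 2)
      ≤ ENNReal.ofReal ((√(2 * m + 2) * S * N) ^ 2) ^ ((1:ℝ) / 2) := by gcongr
    _ = ENNReal.ofReal (√(2 * m + 2) * S * N) := by
        rw [ENNReal.ofReal_rpow_of_nonneg (by positivity) (by norm_num), ← Real.sqrt_eq_rpow,
          Real.sqrt_sq (by positivity)]
    _ ≤ _ := by
        apply ENNReal.ofReal_le_ofReal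
        rw [add_mul]
        linarith
end
end
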